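/- Let d ≥ 2, 1 < p < ∞ and R₀ > 0, and let u be a positive C¹ weak solution of -Δ_p w = 0 in the exterior domain { x ∈ ℝ^d : ‖x‖ > R₀ }. Then either u(x) converges to a finite nonnegative limit as ‖x‖ → ∞, or lim_{‖x‖ → ∞} u(x) = +∞. Moreover, if p ≥ d, then u cannot tend to 0 at infinity: the finite limit, when it occurs, is strictly positive. -/

import Mathlib

open MeasureTheory Metric Filter Topology Set
open scoped RealInnerProductSpace

noncomputable section

/-- `u` is a positive `C¹` weak solution of `-Δ_p u + V|u|^{p-2}u = 0` in the open set `Ω`. -/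
def IsPosWeakSol {d : ℕ} (p : ℝ) (V : EuclideanSpace ℝ (Fin d) → ℝ)
    (Ω : Set (EuclideanSpace ℝ (Fin d))) (u : EuclideanSpace ℝ (Fin d) → ℝ) : Prop :=
  ContDiffOn ℝ 1 u Ω ∧ (∀ x ∈ Ω, 0 < u x) ∧
  ∀ φ : EuclideanSpace ℝ (Fin d) → ℝ, ContDiff ℝ (⊤ : ℕ∞) φ → HasCompactSupport φ →
    tsupport φ ⊆ Ω →
    ∫ x in Ω, (‖gradient u x‖ ^ (p - 2) * ⟪gradient u x, gradient φ x⟫ +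
      V x * |u x| ^ (p - 2) * u x * φ x) = 0

set_option linter.unusedSectionVars false

section PHarmonic

variable {E : Type*} [NormedAddCommGroup E] [InnerProductSpace ℝ E] [FiniteDimensional ℝ E]

theorem measurable_gradient [MeasurableSpace E] [BorelSpace E] (u : E → ℝ) :
    Measurable (gradient u) := by
  unfold gradient
  exact (LinearIsometryEquiv.continuous _).measurable.comp (measurable_fderiv ℝ u)

theorem norm_gradient (u : E → ℝ) (x : E) : ‖gradient u x‖ = ‖fderiv ℝ u x‖ := by
  simp [gradient]

theorem fderiv_apply_gradient_self (u : E → ℝ) (x : E) :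
    fderiv ℝ u x (gradient u x) = ‖gradient u x‖ ^ 2 := by
  rw [← inner_gradient_left, real_inner_self_eq_norm_sq]

theorem Real.rpow_sub_two_mul_self {p t : ℝ} (hp : 1 < p) (ht : 0 ≤ t) :
    t ^ (p - 2) * t = t ^ (p - 1) := by
  rcases ht.eq_or_lt with rfl | h
  · rw [mul_zero, Real.zero_rpow (by linarith)]
  · rw [← Real.rpow_add_one h.ne']; ring_nf

theorem abs_flux_apply_le {p : ℝ} (hp : 1 < p) (z : E) (l : E →L[ℝ] ℝ) :
    |‖z‖ ^ (p - 2) * l z| ≤ ‖z‖ ^ (p - 1) * ‖l‖ := by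
  rw [abs_mul, abs_of_nonneg (by positivity), ← Real.rpow_sub_two_mul_self hp (norm_nonneg z)]
  have := l.le_opNorm z
  rw [Real.norm_eq_abs] at this
  calc ‖z‖ ^ (p - 2) * |l z| ≤ ‖z‖ ^ (p - 2) * (‖l‖ * ‖z‖) := by gcongr
    _ = _ := by ring

variable [MeasurableSpace E] [BorelSpace E]

/-- `u` is a `C¹` weak solution of `-Δ_p u = 0` in `Ω`, tested against `C¹` functions with compact
support in `Ω`. -/
def IsPHarmonicOn (p : ℝ) (Ω : Set E) (u : E → ℝ) : Prop :=
  ContDiffOn ℝ 1 u Ω ∧ ∀ φ : E → ℝ, ContDiff ℝ 1 φ → HasCompactSupport φ → tsupport φ ⊆ Ω →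
    ∫ x, ‖gradient u x‖ ^ (p - 2) * fderiv ℝ φ x (gradient u x) = 0

theorem IsPHarmonicOn.mono {p : ℝ} {Ω Ω' : Set E} {u : E → ℝ} (hu : IsPHarmonicOn p Ω u)
    (h : Ω' ⊆ Ω) : IsPHarmonicOn p Ω' u :=
  ⟨hu.1.mono h, fun φ h1 h2 h3 => hu.2 φ h1 h2 (h3.trans h)⟩

/-- A `C¹` function with compact support in an open set is a `C¹` limit of smooth functions
supported in a fixed compact subset. -/
theorem exists_smooth_approx {Ω : Set E} (hΩ : IsOpen Ω) {φ : E → ℝ} (hφ : ContDiff ℝ 1 φ)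
    (hc : HasCompactSupport φ) (hs : tsupport φ ⊆ Ω) :
    ∃ K : Set E, IsCompact K ∧ K ⊆ Ω ∧ tsupport φ ⊆ K ∧ ∀ ε > 0, ∃ ψ : E → ℝ,
      ContDiff ℝ (⊤ : ℕ∞) ψ ∧ tsupport ψ ⊆ K ∧
      ∀ x, ‖fderiv ℝ ψ x - fderiv ℝ φ x‖ ≤ ε := by
  obtain ⟨δ, hδ, hδΩ⟩ := hc.isCompact.exists_cthickening_subset_open hΩ hs
  refine ⟨cthickening δ (tsupport φ), hc.isCompact.cthickening, hδΩ,
    self_subset_cthickening _, fun ε hε => ?_⟩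
  have huc : UniformContinuous (fderiv ℝ φ) :=
    (hφ.continuous_fderiv one_ne_zero).uniformContinuous_of_tendsto_cocompact
      (by simpa using (hc.fderiv ℝ).is_zero_at_infty) 
  obtain ⟨η, hη, hηε⟩ := Metric.uniformContinuous_iff.1 huc ε hε
  have hm : 0 < min δ η := lt_min hδ hη
  let b : ContDiffBump (0 : E) := ⟨min δ η / 2, min δ η, by linarith, by linarith⟩
  have hfd : ∀ x, HasFDerivAt (MeasureTheory.convolution (b.normed volume) φ
      (ContinuousLinearMap.lsmul ℝ ℝ) volume)
      (MeasureTheory.convolution (b.normed volume) (fderiv ℝ φ)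
      (ContinuousLinearMap.lsmul ℝ ℝ) volume x) x := fun x =>
    hc.hasFDerivAt_convolution_right (ContinuousLinearMap.lsmul ℝ ℝ)
      (b.continuous_normed (μ := volume)).locallyIntegrable hφ x
  refine ⟨MeasureTheory.convolution (b.normed volume) φ (ContinuousLinearMap.lsmul ℝ ℝ) volume,
    ?_, ?_, fun x => ?_⟩
  · exact HasCompactSupport.contDiff_convolution_left _ b.hasCompactSupport_normed b.contDiff_normed
      hφ.continuous.locallyIntegrable
  · refine closure_minimal (fun x hx => ?_) isClosed_cthickening
    obtain ⟨y, hy, z, hz, rfl⟩ := support_convolution_subset _ hx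
    rw [b.support_normed_eq, mem_ball, dist_zero_right] at hy
    refine mem_cthickening_of_dist_le (y + z) z δ _ (subset_tsupport _ hz) ?_
    rw [dist_eq_norm, add_sub_cancel_right]
    exact hy.le.trans (min_le_left _ _)
  · rw [(hfd x).fderiv, ← dist_eq_norm]
    refine ContDiffBump.dist_normed_convolution_le
      (hφ.continuous_fderiv one_ne_zero).aestronglyMeasurable fun y hy => (hηε ?_).le
    exact lt_of_lt_of_le (mem_ball.1 hy) (min_le_right _ _)

theorem ContDiffOn.continuousOn_norm_gradient {Ω : Set E} (hΩ : IsOpen Ω) {u : E → ℝ}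
    (hu : ContDiffOn ℝ 1 u Ω) : ContinuousOn (fun x => ‖gradient u x‖) Ω := by
  simp only [norm_gradient]
  exact (hu.continuousOn_fderiv_of_isOpen hΩ le_rfl).norm

theorem integrable_flux_apply {p : ℝ} (hp : 1 < p) {Ω : Set E} (hΩ : IsOpen Ω) {u : E → ℝ}
    (hu : ContDiffOn ℝ 1 u Ω) {φ : E → ℝ} (hφ : ContDiff ℝ 1 φ) (hc : HasCompactSupport φ)
    (hs : tsupport φ ⊆ Ω) :
    Integrable fun x => ‖gradient u x‖ ^ (p - 2) * fderiv ℝ φ x (gradient u x) := by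
  have hcont := (ContDiffOn.continuousOn_norm_gradient hΩ hu).rpow_const
    (p := p - 1) (fun _ _ => Or.inr (by linarith))
  have hi : IntegrableOn (fun x => ‖gradient u x‖ ^ (p - 1) * ‖fderiv ℝ φ x‖) (tsupport φ) :=
    ((hcont.mono hs).mul (hφ.continuous_fderiv one_ne_zero).norm.continuousOn).integrableOn_compact
      hc.isCompact
  have hm : Measurable fun x => ‖gradient u x‖ ^ (p - 2) * fderiv ℝ φ x (gradient u x) := by
    refine ((measurable_gradient u).norm.pow_const _).mul ?_
    simp only [← inner_gradient_left]
    exact (measurable_gradient φ).inner (measurable_gradient u)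
  have hi2 : IntegrableOn (fun x => ‖gradient u x‖ ^ (p - 2) * fderiv ℝ φ x (gradient u x))
      (tsupport φ) := by
    refine Integrable.mono' hi hm.aestronglyMeasurable (Eventually.of_forall fun x => ?_)
    exact abs_flux_apply_le hp _ _
  refine (integrableOn_iff_integrable_of_support_subset fun x hx => ?_).1 hi2
  by_contra h
  have : fderiv ℝ φ x = 0 := by
    by_contra h'
    exact h (support_fderiv_subset ℝ h')
  simp [this] at hx

/-- Weak solutions tested against smooth functions may be tested against `C¹` functions. -/
theorem isPHarmonicOn_of_smooth {p : ℝ} (hp : 1 < p) {Ω : Set E} (hΩ : IsOpen Ω) {u : E → ℝ}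
    (hu : ContDiffOn ℝ 1 u Ω)
    (h : ∀ φ : E → ℝ, ContDiff ℝ (⊤ : ℕ∞) φ → HasCompactSupport φ → tsupport φ ⊆ Ω →
      ∫ x, ‖gradient u x‖ ^ (p - 2) * fderiv ℝ φ x (gradient u x) = 0) :
    IsPHarmonicOn p Ω u := by
  refine ⟨hu, fun φ hφ hc hs => ?_⟩
  obtain ⟨K, hK, hKΩ, hφK, happ⟩ := exists_smooth_approx hΩ hφ hc hs
  set M := ∫ x in K, ‖gradient u x‖ ^ (p - 1) with hM
  have hcont := (ContDiffOn.continuousOn_norm_gradient hΩ hu).rpow_const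
    (p := p - 1) (fun _ _ => Or.inr (by linarith))
  have hMi : IntegrableOn (fun x => ‖gradient u x‖ ^ (p - 1)) K :=
    (hcont.mono hKΩ).integrableOn_compact hK
  have hM0 : 0 ≤ M := integral_nonneg fun x => by positivity
  have key : ∀ ε > 0, |∫ x, ‖gradient u x‖ ^ (p - 2) * fderiv ℝ φ x (gradient u x)| ≤ ε * M := by
    intro ε hε
    obtain ⟨ψ, h1, h2, h3⟩ := happ ε hε
    have hψc : HasCompactSupport ψ := hK.of_isClosed_subset (isClosed_tsupport _) h2
    have e1 := h ψ h1 hψc (h2.trans hKΩ)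
    have i1 := integrable_flux_apply hp hΩ hu (h1.of_le (by simp)) hψc (h2.trans hKΩ)
    have i2 := integrable_flux_apply hp hΩ hu hφ hc hs
    have e2 : ∫ x, ‖gradient u x‖ ^ (p - 2) * fderiv ℝ φ x (gradient u x) =
        ∫ x in K, ‖gradient u x‖ ^ (p - 2) * (fderiv ℝ φ x - fderiv ℝ ψ x) (gradient u x) := by
      rw [setIntegral_eq_integral_of_forall_compl_eq_zero, ← sub_zero (∫ x, _), ← e1,
        ← integral_sub i2 i1]
      · congr with x
        simp [mul_sub]
      · intro x hx
        have a1 : fderiv ℝ φ x = 0 := by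
          by_contra h'
          exact hx (hφK (support_fderiv_subset ℝ h'))
        have a2 : fderiv ℝ ψ x = 0 := by
          by_contra h'
          exact hx (h2 (support_fderiv_subset ℝ h'))
        simp [a1, a2]
    rw [e2, hM, ← integral_const_mul, ← Real.norm_eq_abs]
    refine norm_integral_le_of_norm_le (hMi.const_mul ε) (Eventually.of_forall fun x => ?_)
    rw [Real.norm_eq_abs]
    refine (abs_flux_apply_le hp _ _).trans ?_
    rw [mul_comm]
    gcongr
    rw [norm_sub_rev]
    exact h3 x
  by_contra hne
  have hpos := abs_pos.2 hne
  have := key (|∫ x, ‖gradient u x‖ ^ (p - 2) * fderiv ℝ φ x (gradient u x)| / (2 * (M + 1)))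
    (by positivity)
  rw [div_mul_eq_mul_div, le_div_iff₀ (by positivity)] at this
  nlinarith

end PHarmonic

theorem IsPosWeakSol.isPHarmonicOn {d : ℕ} {p : ℝ} (hp : 1 < p)
    {Ω : Set (EuclideanSpace ℝ (Fin d))} (hΩ : IsOpen Ω) {u : EuclideanSpace ℝ (Fin d) → ℝ}
    (hu : IsPosWeakSol p (fun _ => 0) Ω u) : IsPHarmonicOn p Ω u := by
  refine isPHarmonicOn_of_smooth hp hΩ hu.1 fun φ h1 h2 h3 => ?_
  have := hu.2.2 φ h1 h2 h3
  rw [setIntegral_eq_integral_of_forall_compl_eq_zero] at this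
  · rw [← this]
    congr with x
    simp [inner_gradient_right]
  · intro x hx
    have a1 : fderiv ℝ φ x = 0 := by
      by_contra h'
      exact hx (h3 (support_fderiv_subset ℝ h'))
    simp [gradient, a1]

theorem hasDerivAt_posPart_rpow {p : ℝ} (hp : 1 < p) (s : ℝ) :
    HasDerivAt (fun s : ℝ => (max s 0) ^ p) (p * (max s 0) ^ (p - 1)) s := by
  rcases lt_trichotomy s 0 with h | h | h
  · rw [max_eq_right h.le, Real.zero_rpow (by linarith), mul_zero]
    refine (hasDerivAt_const s (0 : ℝ)).congr_of_eventuallyEq ?_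
    filter_upwards [Iio_mem_nhds h] with t ht
    rw [max_eq_right (le_of_lt ht), Real.zero_rpow (by linarith)]
  · subst h
    have h1 := Real.hasDerivAt_rpow_const (x := 0) (p := p) (Or.inr hp.le)
    rw [max_self, Real.zero_rpow (by linarith), mul_zero]
    rw [Real.zero_rpow (by linarith), mul_zero, hasDerivAt_iff_isLittleO] at h1
    rw [hasDerivAt_iff_isLittleO]
    simp only [max_self, Real.zero_rpow (by linarith : p ≠ 0), sub_zero, smul_zero] at h1 ⊢
    refine (Asymptotics.IsBigO.of_bound 1 (Eventually.of_forall fun t => ?_)).trans_isLittleO h1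
    rcases le_total t 0 with h | h
    · rw [max_eq_right h, Real.zero_rpow (by linarith)]; simp
    · rw [max_eq_left h]; simp
  · rw [max_eq_left h.le]
    refine (Real.hasDerivAt_rpow_const (Or.inl h.ne')).congr_of_eventuallyEq ?_
    filter_upwards [Ioi_mem_nhds h] with t ht
    rw [max_eq_left (le_of_lt ht)]

theorem contDiff_posPart_rpow {p : ℝ} (hp : 1 < p) :
    ContDiff ℝ 1 (fun s : ℝ => (max s 0) ^ p) := by
  rw [contDiff_one_iff_deriv]
  refine ⟨fun s => (hasDerivAt_posPart_rpow hp s).differentiableAt, ?_⟩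
  have : deriv (fun s : ℝ => (max s 0) ^ p) = fun s => p * (max s 0) ^ (p - 1) :=
    funext fun s => (hasDerivAt_posPart_rpow hp s).deriv
  rw [this]
  exact continuous_const.mul ((continuous_id.max continuous_const).rpow_const
    fun _ => Or.inr (by linarith))

theorem young_absorb {p a b : ℝ} (hp : 1 < p) (ha : 0 ≤ a) (hb : 0 ≤ b) :
    p * a ^ (p - 1) * b ≤ 1 / 2 * a ^ p + (2 * p) ^ p * b ^ p := by
  have hp0 : 0 < p := by linarith
  have e : ∀ t : ℝ, 0 ≤ t → t ^ p = t ^ (p - 1) * t := fun t ht => by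
    rcases ht.eq_or_lt with rfl | h
    · rw [mul_zero, Real.zero_rpow hp0.ne']
    · rw [← Real.rpow_add_one h.ne']; ring_nf
  rcases le_total (2 * p * b) a with h | h
  · have h1 : a ^ (p - 1) * (2 * p * b) ≤ a ^ (p - 1) * a := by gcongr
    rw [← e a ha] at h1
    have : 0 ≤ (2 * p) ^ p * b ^ p := by positivity
    linarith
  · have h1 : a ^ (p - 1) ≤ (2 * p * b) ^ (p - 1) :=
      Real.rpow_le_rpow ha h (by linarith)
    have h2 : (2 * p) ^ p * b ^ p = (2 * p * b) ^ (p - 1) * (2 * p * b) := by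
      rw [← e _ (by positivity), Real.mul_rpow (by positivity) hb]
    have h3 : a ^ (p - 1) * (2 * p * b) ≤ (2 * p * b) ^ (p - 1) * (2 * p * b) := by gcongr
    have h4 : 0 ≤ a ^ p := by positivity
    have h5 : 0 ≤ a ^ (p - 1) * (p * b) := by positivity
    rw [h2]
    linarith

section PHarmonic

variable {E : Type*} [NormedAddCommGroup E] [InnerProductSpace ℝ E] [FiniteDimensional ℝ E]
  [MeasurableSpace E] [BorelSpace E]

/-- The class of `p`-harmonic functions is invariant under affine changes of values and
homotheties of space. -/
theorem IsPHarmonicOn.comp_homothety {p : ℝ} {Ω : Set E} (hΩ : IsOpen Ω) {u : E → ℝ}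
    (hu : IsPHarmonicOn p Ω u) (a b : ℝ) (y : E) {ρ : ℝ} (hρ : 0 < ρ) :
    IsPHarmonicOn p {x | y + ρ • x ∈ Ω} fun x => a * u (y + ρ • x) + b := by
  have hA : ContDiff ℝ 1 fun x : E => y + ρ • x := by fun_prop
  have hd : ∀ x, y + ρ • x ∈ Ω →
      gradient (fun x => a * u (y + ρ • x) + b) x = (a * ρ) • gradient u (y + ρ • x) := by
    intro x hx
    have h1 : HasFDerivAt u (fderiv ℝ u (y + ρ • x)) (y + ρ • x) :=
      ((hu.1.differentiableOn one_ne_zero).differentiableAt (hΩ.mem_nhds hx)).hasFDerivAt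
    have h2 : HasFDerivAt (fun x : E => y + ρ • x) (ρ • ContinuousLinearMap.id ℝ E) x :=
      ((hasFDerivAt_id x).const_smul ρ).const_add y
    have h3 := ((h1.comp x h2).const_mul a).add_const b
    have h4 : fderiv ℝ (fun x => a * u (y + ρ • x) + b) x = (a * ρ) • fderiv ℝ u (y + ρ • x) := by
      refine h3.fderiv.trans ?_
      ext z
      simp [mul_assoc]
    unfold gradient
    rw [h4]
    simp
  refine ⟨?_, fun φ hφ hc hs => ?_⟩
  · exact (contDiffOn_const.mul (hu.1.comp hA.contDiffOn fun x hx => hx)).add contDiffOn_const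
  · let e : E ≃ₜ E := (Homeomorph.smulOfNeZero ρ hρ.ne').trans (Homeomorph.addLeft y)
    have he : ∀ x, e x = y + ρ • x := fun x => rfl
    have hes : ∀ z, e.symm z = ρ⁻¹ • (-y + z) := fun z => by
      rw [Homeomorph.symm_apply_eq, he, smul_smul, mul_inv_cancel₀ hρ.ne']; simp
    have hψ : ContDiff ℝ 1 (φ ∘ e.symm) := by
      refine hφ.comp ?_
      have : (e.symm : E → E) = fun z => ρ⁻¹ • (-y + z) := funext hes
      rw [this]; fun_prop
    have hψc : HasCompactSupport (φ ∘ e.symm) := hc.comp_homeomorph e.symm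
    have hψs : tsupport (φ ∘ e.symm) ⊆ Ω := by
      rw [tsupport_comp_eq_preimage]
      intro z hz
      have := hs hz
      simp only [mem_ofPred_eq, ← he] at this
      simpa using this
    have hfd : ∀ x, fderiv ℝ (φ ∘ e.symm) (y + ρ • x) = ρ⁻¹ • fderiv ℝ φ x := by
      intro x
      have h2 : HasFDerivAt (e.symm : E → E) (ρ⁻¹ • ContinuousLinearMap.id ℝ E) (y + ρ • x) := by
        have : (e.symm : E → E) = fun z => ρ⁻¹ • (-y + z) := funext hes
        rw [this]
        exact ((hasFDerivAt_id _).const_add (-y)).const_smul ρ⁻¹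
      have h1 : HasFDerivAt φ (fderiv ℝ φ x) (e.symm (y + ρ • x)) := by
        rw [← he, e.symm_apply_apply]
        exact (hφ.differentiable one_ne_zero x).hasFDerivAt
      rw [(h1.comp _ h2).fderiv]
      ext z
      simp
    have key := hu.2 _ hψ hψc hψs
    set H : E → ℝ := fun z => ‖gradient u z‖ ^ (p - 2) * fderiv ℝ (φ ∘ e.symm) z (gradient u z)
      with hH
    have h0 : ∫ x, H (y + ρ • x) = 0 := by
      rw [Measure.integral_comp_smul volume (fun x => H (y + x)) ρ, integral_add_left_eq_self H y,
        key, smul_zero]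
    have h1 : (fun x => ‖gradient (fun x => a * u (y + ρ • x) + b) x‖ ^ (p - 2) *
        fderiv ℝ φ x (gradient (fun x => a * u (y + ρ • x) + b) x)) =
        fun x => (|a * ρ| ^ (p - 2) * (a * ρ * ρ)) * H (y + ρ • x) := by
      funext x
      by_cases hx : x ∈ tsupport φ
      · rw [hd x (hs hx), hH]
        simp only [hfd]
        rw [norm_smul, Real.norm_eq_abs, Real.mul_rpow (abs_nonneg _) (norm_nonneg _)]
        simp only [map_smul, smul_eq_mul, _root_.smul_apply]
        field_simp
      · have : fderiv ℝ φ x = 0 := by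
          by_contra h'
          exact hx (support_fderiv_subset ℝ h')
        simp [hH, hfd, this]
    rw [h1, integral_const_mul, h0, mul_zero]

/-- A Caccioppoli type inequality, obtained by testing with `ζ₊ ^ p * G`, where `G` is a
nonincreasing function of `u`. -/
theorem IsPHarmonicOn.caccioppoli {p : ℝ} (hp : 1 < p) {Ω U : Set E} (hΩ : IsOpen Ω)
    (hU : IsOpen U) (hUΩ : U ⊆ Ω) {u : E → ℝ} (hu : IsPHarmonicOn p Ω u) {φ ζ G g w : E → ℝ}
    {ζ' : E → E →L[ℝ] ℝ} (hφ : ContDiff ℝ 1 φ) (hc : HasCompactSupport φ) (hs : tsupport φ ⊆ Ω)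
    (hφU : ∀ x ∈ U, φ x = (max (ζ x) 0) ^ p * G x) (hφ0 : ∀ x ∉ U, φ x = 0)
    (hζ : ∀ x ∈ U, HasFDerivAt ζ (ζ' x) x)
    (hG : ∀ x ∈ U, HasFDerivAt G (-(g x) • fderiv ℝ u x) x)
    (hG0 : ∀ x ∈ U, 0 ≤ G x) (hg0 : ∀ x ∈ U, 0 ≤ g x) (hw0 : ∀ x ∈ U, 0 ≤ w x)
    (hw : ∀ x ∈ U, 0 < ζ x → G x ≤ w x * g x ^ ((p - 1) / p))
    (hgc : ContinuousOn g U)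
    (hM : IntegrableOn (fun x => (w x * ‖ζ' x‖) ^ p) (U ∩ {x | 0 < ζ x})) :
    IntegrableOn (fun x => (max (ζ x) 0) ^ p * g x * ‖gradient u x‖ ^ p) U ∧
    ∫ x in U, (max (ζ x) 0) ^ p * g x * ‖gradient u x‖ ^ p ≤
      2 * (2 * p) ^ p * ∫ x in U ∩ {x | 0 < ζ x}, (w x * ‖ζ' x‖) ^ p := by
  have hp0 : 0 < p := by linarith
  set I : E → ℝ := fun x => ‖gradient u x‖ ^ (p - 2) * fderiv ℝ φ x (gradient u x) with hI
  have hζc : ContinuousOn ζ U := fun x hx => (hζ x hx).continuousAt.continuousWithinAt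
  have hmeas : MeasurableSet (U ∩ {x | 0 < ζ x}) := by
    have := hζc.isOpen_inter_preimage hU (isOpen_Ioi (a := 0))
    exact this.measurableSet
  set M : E → ℝ := (U ∩ {x | 0 < ζ x}).indicator fun x => (w x * ‖ζ' x‖) ^ p with hMdef
  have hMi : Integrable M := (integrable_indicator_iff hmeas).2 hM
  have hIi : Integrable I := integrable_flux_apply hp hΩ hu.1 hφ hc hs
  have hI0 : ∀ x ∉ U, I x = 0 := by
    intro x hx
    have hmin : IsLocalMin φ x := by
      refine Eventually.of_forall fun z => ?_
      rw [hφ0 x hx]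
      by_cases hz : z ∈ U
      · rw [hφU z hz]
        exact mul_nonneg (by positivity) (hG0 z hz)
      · rw [hφ0 z hz]
    simp [hI, hmin.fderiv_eq_zero]
  have hpt : ∀ x ∈ U, (max (ζ x) 0) ^ p * g x * ‖gradient u x‖ ^ p ≤
      2 * (2 * p) ^ p * M x - 2 * I x := by
    intro x hx
    set η := max (ζ x) 0 with hη
    set t := ‖gradient u x‖ with ht
    have hη0 : 0 ≤ η := le_max_right _ _
    have ht0 : 0 ≤ t := norm_nonneg _
    have hfd : fderiv ℝ φ x = η ^ p • (-(g x) • fderiv ℝ u x) +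
        G x • ((p * η ^ (p - 1)) • ζ' x) := by
      have h1 : HasFDerivAt (fun x => (max (ζ x) 0) ^ p) ((p * η ^ (p - 1)) • ζ' x) x :=
        (hasDerivAt_posPart_rpow hp (ζ x)).comp_hasFDerivAt x (hζ x hx)
      have h2 := h1.mul (hG x hx)
      refine (h2.congr_of_eventuallyEq ?_).fderiv
      filter_upwards [hU.mem_nhds hx] with z hz
      exact hφU z hz
    have hIx : I x = -(η ^ p * g x * t ^ p) + p * η ^ (p - 1) * G x *
        (t ^ (p - 2) * ζ' x (gradient u x)) := by
      have h2 : t ^ (p - 2) * t ^ 2 = t ^ p := by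
        rcases ht0.eq_or_lt with h | h
        · rw [← h, Real.zero_rpow hp0.ne']; simp
        · rw [← Real.rpow_natCast, ← Real.rpow_add h]; norm_num
      simp only [hI, hfd]
      simp only [_root_.add_apply, _root_.smul_apply,
        fderiv_apply_gradient_self, smul_eq_mul, ← ht]
      rw [← h2]
      ring
    have h3 := abs_flux_apply_le hp (gradient u x) (ζ' x)
    rw [← ht] at h3
    rcases le_or_gt (ζ x) 0 with hz | hz
    · have hη' : η = 0 := max_eq_right hz
      have hMx : M x = 0 := indicator_of_notMem (fun h => (not_lt.2 hz) h.2) _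
      rw [hIx, hMx, hη', Real.zero_rpow hp0.ne', Real.zero_rpow (by linarith)]
      simp
    · have hMx : M x = (w x * ‖ζ' x‖) ^ p := indicator_of_mem (show x ∈ U ∩ {x | 0 < ζ x} from ⟨hx, hz⟩) _
      have hg := hg0 x hx
      have hww := hw0 x hx
      have hy := young_absorb hp (a := η * g x ^ (1 / p) * t) (b := w x * ‖ζ' x‖)
        (by positivity) (by positivity)
      have e1 : (η * g x ^ (1 / p) * t) ^ p = η ^ p * g x * t ^ p := by
        rw [Real.mul_rpow (by positivity) ht0, Real.mul_rpow hη0 (by positivity),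
          ← Real.rpow_mul hg, one_div_mul_cancel hp0.ne', Real.rpow_one]
      have e2 : (η * g x ^ (1 / p) * t) ^ (p - 1) =
          η ^ (p - 1) * g x ^ ((p - 1) / p) * t ^ (p - 1) := by
        rw [Real.mul_rpow (by positivity) ht0, Real.mul_rpow hη0 (by positivity),
          ← Real.rpow_mul hg]
        congr 3; ring
      rw [e1, e2] at hy
      have h4 : -(p * η ^ (p - 1) * G x * (t ^ (p - 2) * ζ' x (gradient u x))) ≥
        -(p * η ^ (p - 1) * (w x * g x ^ ((p - 1) / p)) * (t ^ (p - 1) * ‖ζ' x‖)) := by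
        apply neg_le_neg
        have := hw x hx hz
        have := hG0 x hx
        calc _ ≤ p * η ^ (p - 1) * G x * (t ^ (p - 1) * ‖ζ' x‖) := by
              exact mul_le_mul_of_nonneg_left ((le_abs_self _).trans h3) (by positivity)
          _ ≤ _ := by gcongr
      rw [hIx, hMx]
      nlinarith
  have hQm : AEStronglyMeasurable (fun x => (max (ζ x) 0) ^ p * g x * ‖gradient u x‖ ^ p)
      (volume.restrict U) := by
    refine ContinuousOn.aestronglyMeasurable ?_ hU.measurableSet
    refine (ContinuousOn.mul ?_ hgc).mul ?_
    · exact ((continuous_id.max continuous_const).comp_continuousOn hζc).rpow_const fun _ _ => Or.inr hp0.le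
    · exact ((ContDiffOn.continuousOn_norm_gradient hΩ hu.1).mono hUΩ).rpow_const
        fun _ _ => Or.inr hp0.le
  have hQ0 : ∀ x ∈ U, 0 ≤ (max (ζ x) 0) ^ p * g x * ‖gradient u x‖ ^ p := fun x hx =>
    mul_nonneg (mul_nonneg (by positivity) (hg0 x hx)) (by positivity)
  have hR : Integrable fun x => 2 * (2 * p) ^ p * M x - 2 * I x :=
    (hMi.const_mul _).sub (hIi.const_mul _)
  have hQi : IntegrableOn (fun x => (max (ζ x) 0) ^ p * g x * ‖gradient u x‖ ^ p) U := by
    refine Integrable.mono' hR.integrableOn hQm ?_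
    filter_upwards [ae_restrict_mem hU.measurableSet] with x hx
    rw [Real.norm_of_nonneg (hQ0 x hx)]
    exact hpt x hx
  refine ⟨hQi, ?_⟩
  calc _ ≤ ∫ x in U, (2 * (2 * p) ^ p * M x - 2 * I x) :=
        setIntegral_mono_on hQi hR.integrableOn hU.measurableSet hpt
    _ = ∫ x, (2 * (2 * p) ^ p * M x - 2 * I x) := by
        refine setIntegral_eq_integral_of_forall_compl_eq_zero fun x hx => ?_
        have : M x = 0 := indicator_of_notMem (fun h => hx h.1) _
        rw [this, hI0 x hx]; simp
    _ = 2 * (2 * p) ^ p * ∫ x, M x := by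
        rw [integral_sub (hMi.const_mul _) (hIi.const_mul _), integral_const_mul,
          integral_const_mul, hu.2 φ hφ hc hs]
        simp
    _ = _ := by rw [hMdef, integral_indicator hmeas]

end PHarmonic

section PHarmonic

variable {E : Type*} [NormedAddCommGroup E] [InnerProductSpace ℝ E] [FiniteDimensional ℝ E]
  [MeasurableSpace E] [BorelSpace E]

/-- A Poincaré type inequality: a `C¹` function on the unit ball which is at least `s` on `A` and
nonpositive on `F` has a large gradient in `L¹` unless `A` or `F` is small. -/
theorem mul_volume_mul_volume_le_lintegral_fderiv {f : E → ℝ}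
    (hf : ContDiffOn ℝ 1 f (ball 0 1)) {A F : Set E} (hA : MeasurableSet A) (hF : MeasurableSet F)
    (hAB : A ⊆ ball 0 1) (hFB : F ⊆ ball 0 1) {s : ℝ} (hAs : ∀ x ∈ A, s ≤ f x)
    (hF0 : ∀ x ∈ F, f x ≤ 0) :
    ENNReal.ofReal s * volume A * volume F ≤
      2 * volume (ball (0 : E) 2) * ∫⁻ x in ball 0 1, ‖fderiv ℝ f x‖ₑ := by
  set D : E → ENNReal := (ball 0 1).indicator fun x => ‖fderiv ℝ f x‖ₑ with hD
  have hDm : Measurable D := (measurable_fderiv ℝ f).enorm.indicator measurableSet_ball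
  have hDm3 : Measurable fun q : (E × E) × ℝ => D (q.1.1 + q.2 • q.1.2) := by
    refine hDm.comp ?_
    fun_prop
  have hDm2 : Measurable fun q : E × E => ∫⁻ τ in Icc (0 : ℝ) 1, D (q.1 + τ • q.2) :=
    Measurable.lintegral_prod_right' (ν := volume.restrict (Icc (0 : ℝ) 1)) hDm3
  have hpt : ∀ y h : E, F.indicator 1 y * (A.indicator 1 (y + h) * ENNReal.ofReal s) ≤
      (ball (0 : E) 2).indicator 1 h * (2 * ∫⁻ τ in Icc (0 : ℝ) 1, D (y + τ • h)) := by
    intro y h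
    by_cases hy : y ∈ F
    swap
    · simp [hy]
    by_cases hx : y + h ∈ A
    swap
    · simp [hx]
    have hyB := mem_ball_zero_iff.1 (hFB hy)
    have hxB := mem_ball_zero_iff.1 (hAB hx)
    have hh : ‖h‖ < 2 := by
      have : h = (y + h) - y := by abel
      rw [this]
      exact (norm_sub_le _ _).trans_lt (by linarith)
    have hseg : ∀ τ ∈ Icc (0 : ℝ) 1, y + τ • h ∈ ball (0 : E) 1 := by
      intro τ hτ
      have := (convex_ball (0 : E) 1) (hFB hy) (hAB hx) (sub_nonneg.2 hτ.2) hτ.1 (by ring)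
      convert this using 1
      rw [smul_add, ← add_assoc, ← add_smul]
      simp
    have hline : ContDiff ℝ 1 fun τ : ℝ => y + τ • h := by fun_prop
    have h1 := enorm_sub_le_lintegral_deriv_of_contDiffOn_Icc
      (hf.comp hline.contDiffOn hseg) zero_le_one
    have h2 : ∀ τ ∈ Icc (0 : ℝ) 1, ‖deriv (f ∘ fun τ : ℝ => y + τ • h) τ‖ₑ ≤
        2 * D (y + τ • h) := by
      intro τ hτ
      have hfd := ((hf.differentiableOn one_ne_zero).differentiableAt
        (isOpen_ball.mem_nhds (hseg τ hτ))).hasFDerivAt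
      have hl : HasDerivAt (fun τ : ℝ => y + τ • h) h τ := by
        simpa using ((hasDerivAt_id τ).smul_const h).const_add y
      rw [(hfd.comp_hasDerivAt τ hl).deriv, hD, indicator_of_mem (hseg τ hτ)]
      calc _ ≤ ‖fderiv ℝ f (y + τ • h)‖ₑ * ‖h‖ₑ := ContinuousLinearMap.le_opENorm _ _
        _ ≤ ‖fderiv ℝ f (y + τ • h)‖ₑ * 2 := by
          gcongr
          rw [← ofReal_norm]
          exact ENNReal.ofReal_le_of_le_toReal (by simpa using hh.le)
        _ = _ := mul_comm _ _
    have h3 : ENNReal.ofReal s ≤ ‖(f ∘ fun τ : ℝ => y + τ • h) 1 -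
        (f ∘ fun τ : ℝ => y + τ • h) 0‖ₑ := by
      rw [← ofReal_norm]
      refine ENNReal.ofReal_le_ofReal ((?_ : s ≤ _).trans (le_abs_self _))
      have := hAs _ hx
      have := hF0 _ hy
      simp
      linarith
    rw [indicator_of_mem hy, indicator_of_mem hx, indicator_of_mem (mem_ball_zero_iff.2 hh)]
    simp only [Pi.one_apply, one_mul]
    refine h3.trans (h1.trans ?_)
    rw [← lintegral_const_mul' _ _ (by simp)]
    exact setLIntegral_mono' measurableSet_Icc h2
  calc ENNReal.ofReal s * volume A * volume F
      = ∫⁻ y, ∫⁻ h, F.indicator 1 y * (A.indicator 1 (y + h) * ENNReal.ofReal s) := by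
        have hm : Measurable fun x => A.indicator (1 : E → ENNReal) x * ENNReal.ofReal s :=
          (measurable_one.indicator hA).mul_const _
        have e : ∀ y : E, ∫⁻ h, F.indicator 1 y * (A.indicator 1 (y + h) * ENNReal.ofReal s) =
            F.indicator 1 y * (volume A * ENNReal.ofReal s) := by
          intro y
          have hm' : Measurable fun h =>
              A.indicator (1 : E → ENNReal) (y + h) * ENNReal.ofReal s :=
            hm.comp (measurable_const_add y)
          rw [lintegral_const_mul _ hm',
            lintegral_add_left_eq_self (fun x => A.indicator (1 : E → ENNReal) x *
              ENNReal.ofReal s) y, lintegral_mul_const _ (measurable_one.indicator hA),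
            lintegral_indicator_one hA]
        simp_rw [e]
        rw [lintegral_mul_const _ (measurable_one.indicator hF), lintegral_indicator_one hF]
        ring
    _ ≤ ∫⁻ y, ∫⁻ h, (ball (0 : E) 2).indicator 1 h *
          (2 * ∫⁻ τ in Icc (0 : ℝ) 1, D (y + τ • h)) :=
        lintegral_mono fun y => lintegral_mono fun h => hpt y h
    _ = ∫⁻ h, ∫⁻ y, (ball (0 : E) 2).indicator 1 h *
          (2 * ∫⁻ τ in Icc (0 : ℝ) 1, D (y + τ • h)) := by
        refine lintegral_lintegral_swap (Measurable.aemeasurable ?_)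
        exact ((measurable_one.indicator measurableSet_ball).comp measurable_snd).mul
          (hDm2.const_mul 2)
    _ = ∫⁻ h, (ball (0 : E) 2).indicator 1 h * (2 * ∫⁻ x, D x) := by
        refine lintegral_congr fun h => ?_
        have m1 : Measurable fun y => ∫⁻ τ in Icc (0 : ℝ) 1, D (y + τ • h) :=
          hDm2.comp (measurable_id.prodMk measurable_const)
        rw [lintegral_const_mul _ (m1.const_mul 2), lintegral_const_mul _ m1]
        congr 2
        rw [lintegral_lintegral_swap]
        · simp_rw [lintegral_add_right_eq_self D]
          simp
        · refine Measurable.aemeasurable ?_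
          exact hDm3.comp ((measurable_fst.prodMk measurable_const).prodMk measurable_snd)
    _ = _ := by
        rw [lintegral_mul_const _ (measurable_one.indicator measurableSet_ball),
          lintegral_indicator_one measurableSet_ball, hD, lintegral_indicator measurableSet_ball]
        ring

theorem contDiff_indicator_of_isClosed {U K : Set E} (hU : IsOpen U) (hK : IsClosed K)
    (hKU : K ⊆ U) {φ : E → ℝ} (hφ : ContDiffOn ℝ 1 φ U) (h0 : ∀ x ∈ U, x ∉ K → φ x = 0) :
    ContDiff ℝ 1 (U.indicator φ) ∧ tsupport (U.indicator φ) ⊆ K := by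
  have hs : tsupport (U.indicator φ) ⊆ K := by
    refine closure_minimal (fun x hx => ?_) hK
    by_contra hxK
    by_cases hxU : x ∈ U
    · simp [hxU, h0 x hxU hxK] at hx
    · simp [hxU] at hx
  refine ⟨contDiff_iff_contDiffAt.2 fun x => ?_, hs⟩
  by_cases hx : x ∉ tsupport (U.indicator φ)
  · exact (contDiffAt_const (c := (0 : ℝ))).congr_of_eventuallyEq
      (notMem_tsupport_iff_eventuallyEq.1 hx)
  rw [not_not] at hx
  have hxU := hU.mem_nhds (hKU (hs hx))
  refine (hφ.contDiffAt hxU).congr_of_eventuallyEq ?_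
  filter_upwards [hxU] with z hz
  exact indicator_of_mem hz _

theorem contDiff_indicator_of_isCompact {U K : Set E} (hU : IsOpen U) (hK : IsCompact K)
    (hKU : K ⊆ U) {φ : E → ℝ} (hφ : ContDiffOn ℝ 1 φ U) (h0 : ∀ x ∈ U, x ∉ K → φ x = 0) :
    ContDiff ℝ 1 (U.indicator φ) ∧ HasCompactSupport (U.indicator φ) ∧
      tsupport (U.indicator φ) ⊆ K := by
  obtain ⟨h, hs⟩ := contDiff_indicator_of_isClosed hU hK.isClosed hKU hφ h0
  exact ⟨h, hK.of_isClosed_subset (isClosed_tsupport _) hs, hs⟩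

/-- Caccioppoli inequality where the test function is given by its values in an open set and
vanishes there outside a compact subset. -/
theorem IsPHarmonicOn.caccioppoli_indicator {p : ℝ} (hp : 1 < p) {U K : Set E}
    (hU : IsOpen U) (hK : IsCompact K) (hKU : K ⊆ U) {u : E → ℝ} (hu : IsPHarmonicOn p U u)
    {ζ G g w : E → ℝ} {ζ' : E → E →L[ℝ] ℝ} (hζ1 : ContDiffOn ℝ 1 ζ U) (hG1 : ContDiffOn ℝ 1 G U)
    (h0 : ∀ x ∈ U, x ∉ K → ζ x ≤ 0 ∨ G x = 0)
    (hζ : ∀ x ∈ U, HasFDerivAt ζ (ζ' x) x)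
    (hG : ∀ x ∈ U, HasFDerivAt G (-(g x) • fderiv ℝ u x) x)
    (hG0 : ∀ x ∈ U, 0 ≤ G x) (hg0 : ∀ x ∈ U, 0 ≤ g x) (hw0 : ∀ x ∈ U, 0 ≤ w x)
    (hw : ∀ x ∈ U, 0 < ζ x → G x ≤ w x * g x ^ ((p - 1) / p))
    (hgc : ContinuousOn g U)
    (hM : IntegrableOn (fun x => (w x * ‖ζ' x‖) ^ p) (U ∩ {x | 0 < ζ x})) :
    IntegrableOn (fun x => (max (ζ x) 0) ^ p * g x * ‖gradient u x‖ ^ p) U ∧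
    ∫ x in U, (max (ζ x) 0) ^ p * g x * ‖gradient u x‖ ^ p ≤
      2 * (2 * p) ^ p * ∫ x in U ∩ {x | 0 < ζ x}, (w x * ‖ζ' x‖) ^ p := by
  have hφ1 : ContDiffOn ℝ 1 (fun x => (max (ζ x) 0) ^ p * G x) U :=
    ((contDiff_posPart_rpow hp).comp_contDiffOn hζ1).mul hG1
  obtain ⟨a1, a2, a3⟩ := contDiff_indicator_of_isCompact hU hK hKU hφ1 (fun x hx hxK => by
    rcases h0 x hx hxK with h | h
    · rw [max_eq_right h, Real.zero_rpow (by linarith), zero_mul]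
    · rw [h, mul_zero])
  exact hu.caccioppoli hp hU hU Subset.rfl a1 a2 (a3.trans hKU)
    (fun x hx => indicator_of_mem hx _) (fun x hx => indicator_of_notMem hx _) hζ hG hG0 hg0 hw0
    hw hgc hM

theorem hasFDerivAt_const_sub_norm_sq (c : ℝ) (x : E) :
    HasFDerivAt (fun x : E => c - ‖x‖ ^ 2) (-(2 • innerSL ℝ x)) x :=
  (hasStrictFDerivAt_norm_sq x).hasFDerivAt.const_sub c

theorem norm_neg_two_smul_innerSL (x : E) : ‖-(2 • innerSL ℝ x)‖ = 2 * ‖x‖ := by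
  rw [norm_neg, ← Nat.cast_smul_eq_nsmul ℝ, norm_smul]
  simp

/-- The logarithm of a positive `p`-harmonic function has a gradient bounded in `L¹`. -/
theorem exists_lintegral_fderiv_log_le {p : ℝ} (hp : 1 < p) :
    ∃ C : ℝ, 0 < C ∧ ∀ v : E → ℝ, IsPHarmonicOn p (ball 0 2) v → (∀ x ∈ ball (0 : E) 2, 0 < v x) →
      ∫⁻ x in ball 0 1, ‖fderiv ℝ (fun x => Real.log (v x)) x‖ₑ ≤ ENNReal.ofReal C := by
  have hp0 : 0 < p := by linarith
  have hp1 : 0 < p - 1 := by linarith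
  set c0 : ℝ := ((p - 1) ^ ((p - 1) / p))⁻¹ with hc0
  have hc0p : 0 < c0 := by positivity
  set V1 := volume.real (ball (0 : E) 1)
  set V2 := volume.real (ball (0 : E) 2)
  refine ⟨V1 + (2 * (2 * p) ^ p * ((c0 * 4) ^ p * V2)) / (p - 1) + 1, by positivity,
    fun v hv hv0 => ?_⟩
  have hdiff : ∀ x ∈ ball (0 : E) 2, HasFDerivAt v (fderiv ℝ v x) x := fun x hx =>
    ((hv.1.differentiableOn one_ne_zero).differentiableAt (isOpen_ball.mem_nhds hx)).hasFDerivAt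
  have hvc : ContinuousOn v (ball 0 2) := hv.1.continuousOn
  have hbd : ∀ x : E, x ∈ ball (0 : E) 2 → (c0 * ‖-(2 • innerSL ℝ x)‖) ^ p ≤ (c0 * 4) ^ p := by
    intro x hx
    rw [norm_neg_two_smul_innerSL]
    have := mem_ball_zero_iff.1 hx
    gcongr
    linarith
  have hcontM : Continuous fun x : E => (c0 * ‖-(2 • innerSL ℝ x)‖) ^ p := by
    simp only [norm_neg_two_smul_innerSL]
    exact (by fun_prop : Continuous fun x : E => c0 * (2 * ‖x‖)).rpow_const fun _ => Or.inr hp0.le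
  have hS : MeasurableSet (ball (0 : E) 2 ∩ {x | 0 < 9 / 4 - ‖x‖ ^ 2}) :=
    measurableSet_ball.inter (measurableSet_lt measurable_const (by fun_prop))
  have hfin : volume (ball (0 : E) 2 ∩ {x | 0 < 9 / 4 - ‖x‖ ^ 2}) ≠ ⊤ :=
    measure_ne_top_of_subset inter_subset_left measure_ball_lt_top.ne
  have hMint : IntegrableOn (fun x : E => (c0 * ‖-(2 • innerSL ℝ x)‖) ^ p)
      (ball 0 2 ∩ {x | 0 < 9 / 4 - ‖x‖ ^ 2}) := by
    refine IntegrableOn.of_bound hfin.lt_top hcontM.aestronglyMeasurable ((c0 * 4) ^ p) ?_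
    filter_upwards [ae_restrict_mem hS] with x hx
    rw [Real.norm_of_nonneg (by positivity)]
    exact hbd x hx.1
  obtain ⟨hQi, hQ⟩ := hv.caccioppoli_indicator hp isOpen_ball
    (isCompact_closedBall (0 : E) (3 / 2)) (closedBall_subset_ball (by norm_num))
    (ζ := fun x => 9 / 4 - ‖x‖ ^ 2) (G := fun x => v x ^ (1 - p))
    (g := fun x => (p - 1) * v x ^ (-p)) (w := fun _ => c0) (ζ' := fun x => -(2 • innerSL ℝ x))
    (contDiff_const.sub (contDiff_norm_sq ℝ)).contDiffOn
    (hv.1.rpow_const_of_ne fun x hx => (hv0 x hx).ne')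
    (fun x _ hxK => Or.inl (by
      rw [mem_closedBall_zero_iff, not_le] at hxK
      nlinarith))
    (fun x _ => hasFDerivAt_const_sub_norm_sq _ x)
    (fun x hx => by
      have := (hdiff x hx).rpow_const (p := 1 - p) (Or.inl (hv0 x hx).ne')
      convert this using 2
      rw [show 1 - p - 1 = -p by ring]; ring)
    (fun x hx => by have := hv0 x hx; positivity)
    (fun x hx => by have := hv0 x hx; positivity)
    (fun x hx => hc0p.le)
    (fun x hx _ => le_of_eq (by
      have := hv0 x hx
      rw [Real.mul_rpow hp1.le (by positivity), ← Real.rpow_mul this.le, ← mul_assoc, hc0,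
        inv_mul_cancel₀ (by positivity), one_mul]
      congr 1
      field_simp
      ring))
    (continuousOn_const.mul (hvc.rpow_const fun x hx => Or.inl (hv0 x hx).ne'))
    hMint
  set Q : E → ℝ := fun x => (max (9 / 4 - ‖x‖ ^ 2) 0) ^ p * ((p - 1) * v x ^ (-p)) *
    ‖gradient v x‖ ^ p with hQdef
  have hQ2 : ∫ x in ball 0 2, Q x ≤ 2 * (2 * p) ^ p * ((c0 * 4) ^ p * V2) := by
    refine hQ.trans ?_
    gcongr
    calc _ ≤ (c0 * 4) ^ p * volume.real (ball (0 : E) 2 ∩ {x | 0 < 9 / 4 - ‖x‖ ^ 2}) := by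
          have := setIntegral_mono_on hMint (integrableOn_const (C := (c0 * 4) ^ p) hfin) hS
            fun x hx => hbd x hx.1
          rw [setIntegral_const] at this
          rwa [mul_comm]
      _ ≤ _ := by
          gcongr
          exact measureReal_mono inter_subset_left measure_ball_lt_top.ne
  have hQ0 : ∀ x ∈ ball (0 : E) 2, 0 ≤ Q x := fun x hx => by
    have := hv0 x hx
    simp only [hQdef]
    positivity
  have hsub : ball (0 : E) 1 ⊆ ball 0 2 := ball_subset_ball (by norm_num)
  have hpt : ∀ x ∈ ball (0 : E) 1, ‖fderiv ℝ (fun x => Real.log (v x)) x‖ ≤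
      1 + Q x / (p - 1) := by
    intro x hx
    have hx2 := hsub hx
    have hvx := hv0 x hx2
    have h1 := ((hdiff x hx2).log hvx.ne').fderiv
    rw [h1, norm_smul, ← norm_gradient, norm_inv, Real.norm_of_nonneg hvx.le]
    set t := (v x)⁻¹ * ‖gradient v x‖ with ht
    have ht0 : 0 ≤ t := by positivity
    have h2 : t ≤ 1 + t ^ p := by
      rcases le_total t 1 with h | h
      · have : 0 ≤ t ^ p := by positivity
        linarith
      · have := Real.self_le_rpow_of_one_le h hp.le
        linarith
    have h3 : t ^ p ≤ Q x / (p - 1) := by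
      have h4 : Q x / (p - 1) = (max (9 / 4 - ‖x‖ ^ 2) 0) ^ p * t ^ p := by
        rw [hQdef, ht, Real.mul_rpow (by positivity) (by positivity), Real.inv_rpow hvx.le,
          ← Real.rpow_neg hvx.le]
        field_simp
      rw [h4]
      have h5 : 1 ≤ max (9 / 4 - ‖x‖ ^ 2) 0 := by
        refine le_max_of_le_left ?_
        have := mem_ball_zero_iff.1 hx
        nlinarith [norm_nonneg x]
      have := Real.one_le_rpow h5 hp0.le
      nlinarith [Real.rpow_nonneg ht0 p]
    linarith
  have hi1 : IntegrableOn (fun x => 1 + Q x / (p - 1)) (ball (0 : E) 1) :=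
    (integrableOn_const measure_ball_lt_top.ne).add ((hQi.mono_set hsub).div_const _)
  calc _ ≤ ∫⁻ x in ball (0 : E) 1, ENNReal.ofReal (1 + Q x / (p - 1)) := by
        refine setLIntegral_mono' measurableSet_ball fun x hx => ?_
        rw [← ofReal_norm]
        exact ENNReal.ofReal_le_ofReal (hpt x hx)
    _ = ENNReal.ofReal (∫ x in ball (0 : E) 1, (1 + Q x / (p - 1))) := by
        rw [ofReal_integral_eq_lintegral_ofReal hi1]
        filter_upwards [ae_restrict_mem measurableSet_ball] with x hx
        have := hQ0 x (hsub hx)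
        show (0 : ℝ) ≤ _
        positivity
    _ ≤ _ := by
        refine ENNReal.ofReal_le_ofReal ?_
        rw [integral_add (show Integrable (fun _ => (1 : ℝ)) (volume.restrict (ball (0 : E) 1)) from
            integrableOn_const measure_ball_lt_top.ne) ((hQi.mono_set hsub).div_const _), setIntegral_const, integral_div]
        have : ∫ x in ball (0 : E) 1, Q x ≤ ∫ x in ball (0 : E) 2, Q x := by
          refine setIntegral_mono_set hQi ?_ hsub.eventuallyLE
          filter_upwards [ae_restrict_mem measurableSet_ball] with x hx using hQ0 x hx
        have h6 : (∫ x in ball (0 : E) 1, Q x) / (p - 1) ≤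
          2 * (2 * p) ^ p * ((c0 * 4) ^ p * V2) / (p - 1) := by
            gcongr; exact this.trans hQ2
        simp only [smul_eq_mul, mul_one]
        linarith

end PHarmonic

theorem tendsto_zero_of_le_mul_pow_rpow {κ C b : ℝ} (hκ : 1 < κ) (hC : 0 < C) (hb : 1 < b) :
    ∃ ε : ℝ, 0 < ε ∧ ∀ a : ℕ → ℝ, (∀ j, 0 ≤ a j) → a 0 ≤ ε →
      (∀ j, a (j + 1) ≤ (C * b ^ j * a j) ^ κ) → Tendsto a atTop (𝓝 0) := by
  have hb0 : 0 < b := by linarith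
  have hκ1 : 0 < κ - 1 := by linarith
  have hκ0 : 0 < κ := by linarith
  set q : ℝ := b ^ (-(κ / (κ - 1))) with hq
  have hq0 : 0 < q := by positivity
  have hq1 : q < 1 := Real.rpow_lt_one_of_one_lt_of_neg hb (by
    have : 0 < κ / (κ - 1) := by positivity
    linarith)
  set ε : ℝ := (q * C ^ (-κ)) ^ (1 / (κ - 1)) with hε
  have hε0 : 0 < ε := by positivity
  have hbq : (b * q) ^ κ = q := by
    have : b * q = b ^ (1 - κ / (κ - 1)) := by
      rw [hq, sub_eq_add_neg 1 (κ / (κ - 1)), Real.rpow_add hb0, Real.rpow_one]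
    rw [this, ← Real.rpow_mul hb0.le, hq]
    congr 1
    field_simp
    ring
  have hεq : (C * ε) ^ κ = ε * q := by
    have h1 : ε ^ (κ - 1) = q * C ^ (-κ) := by
      rw [hε, ← Real.rpow_mul (by positivity), one_div, inv_mul_cancel₀ hκ1.ne', Real.rpow_one]
    rw [Real.mul_rpow hC.le hε0.le, show κ = 1 + (κ - 1) by ring, Real.rpow_add hε0, h1,
      Real.rpow_one, show 1 + (κ - 1) = κ by ring, Real.rpow_neg hC.le]
    field_simp
  refine ⟨ε, hε0, fun a ha0 ha hstep => ?_⟩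
  have key : ∀ j, a j ≤ ε * q ^ j := by
    intro j
    induction j with
    | zero => simpa using ha
    | succ j ih =>
      calc a (j + 1) ≤ (C * b ^ j * a j) ^ κ := hstep j
        _ ≤ (C * b ^ j * (ε * q ^ j)) ^ κ := by
          gcongr
          have := ha0 j
          positivity
        _ = (C * ε) ^ κ * ((b * q) ^ κ) ^ j := by
          rw [← Real.rpow_natCast ((b * q) ^ κ) j, ← Real.rpow_mul (by positivity),
            mul_comm κ (j : ℝ), Real.rpow_mul (by positivity), Real.rpow_natCast,
            ← Real.mul_rpow (by positivity) (by positivity)]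
          congr 1
          rw [mul_pow]; ring
        _ = _ := by rw [hbq, hεq]; ring
  refine squeeze_zero ha0 key ?_
  simpa using (tendsto_pow_atTop_nhds_zero_of_lt_one hq0.le hq1).const_mul ε

section PHarmonic

variable {E : Type*} [NormedAddCommGroup E] [InnerProductSpace ℝ E] [FiniteDimensional ℝ E]
  [MeasurableSpace E] [BorelSpace E]

set_option maxHeartbeats 1000000 in
/-- One step of De Giorgi's iteration on the sublevel sets of a nonnegative `p`-harmonic
function. -/
theorem exists_deGiorgi_step {p κ : ℝ} (hp : 1 < p)
    (hκ : Real.HolderConjugate (Module.finrank ℝ E) κ) :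
    ∃ C : ℝ, 0 < C ∧ ∀ v : E → ℝ, IsPHarmonicOn p (ball 0 2) v → (∀ x ∈ ball (0 : E) 2, 0 ≤ v x) →
      ∀ r' r k' k : ℝ, 0 ≤ r' → r' < r → r ≤ 1 → k' < k → k ≤ 1 →
        volume.real (ball (0 : E) r' ∩ {x | v x < k'}) *
          ((k - k') ^ (p + 1) * (r ^ 2 - r' ^ 2) ^ p) ^ κ ≤
          (C * volume.real (ball (0 : E) r ∩ {x | v x < k})) ^ κ := by
  have hp0 : 0 < p := by linarith
  have hκ1 : 1 < κ := hκ.symm.lt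
  have hκ0 : 0 < κ := by linarith
  set c : NNReal := lintegralPowLePowLIntegralFDerivConst (volume : Measure E) κ with hc
  set C1 : ℝ := 3 * p + 1 + (p + 1) / 2 * (2 * (2 * p) ^ p * 2 ^ p) with hC1
  have hC10 : 0 < C1 := by positivity
  refine ⟨(c + 1 : ℝ) ^ κ⁻¹ * C1, by positivity, fun v hv hv0 r' r k' k hr' hrr hr hkk hk => ?_⟩
  have hr0 : 0 < r := by linarith
  have hdiff : ∀ x ∈ ball (0 : E) 2, HasFDerivAt v (fderiv ℝ v x) x := fun x hx =>
    ((hv.1.differentiableOn one_ne_zero).differentiableAt (isOpen_ball.mem_nhds hx)).hasFDerivAt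
  have hvc : ContinuousOn v (ball 0 2) := hv.1.continuousOn
  set S : Set E := ball 0 2 ∩ {x | v x < k} with hSdef
  have hSm : MeasurableSet S := (hvc.isOpen_inter_preimage isOpen_ball isOpen_Iio).measurableSet
  set A : Set E := ball (0 : E) r ∩ {x | v x < k} with hAdef
  have hbr : ball (0 : E) r ⊆ ball 0 2 := ball_subset_ball (by linarith)
  have hAS : A = ball 0 r ∩ S := by
    ext x
    simp only [hAdef, hSdef, mem_inter_iff]
    constructor
    · rintro ⟨h1, h2⟩; exact ⟨h1, hbr h1, h2⟩
    · rintro ⟨h1, _, h2⟩; exact ⟨h1, h2⟩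
  have hAm : MeasurableSet A := hAS ▸ measurableSet_ball.inter hSm
  have hAfin : volume A ≠ ⊤ := measure_ne_top_of_subset inter_subset_left measure_ball_lt_top.ne
  have hζpos : {x : E | 0 < r ^ 2 - ‖x‖ ^ 2} = ball 0 r := by
    ext x
    rw [mem_ball_zero_iff, mem_ofPred_eq, sub_pos, sq_lt_sq₀ (norm_nonneg _) hr0.le]
  set s : E → ℝ := fun x => max (k - v x) 0 with hs
  have hs0 : ∀ x, 0 ≤ s x := fun x => le_max_right _ _
  have hs1 : ∀ x ∈ ball (0 : E) 2, s x ≤ 1 := fun x hx =>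
    max_le (by have := hv0 x hx; linarith) zero_le_one
  have hsA : ∀ x, k ≤ v x → s x = 0 := fun x hx => max_eq_right (by linarith)
  have hsd : ∀ q : ℝ, 1 < q → ∀ x ∈ ball (0 : E) 2,
      HasFDerivAt (fun x => s x ^ q) (-(q * s x ^ (q - 1)) • fderiv ℝ v x) x := by
    intro q hq x hx
    have := (hasDerivAt_posPart_rpow hq (k - v x)).comp_hasFDerivAt x ((hdiff x hx).const_sub k)
    rwa [smul_neg, ← neg_smul] at this
  have hsC : ∀ q : ℝ, 1 < q → ContDiffOn ℝ 1 (fun x => s x ^ q) (ball 0 2) := fun q hq =>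
    (contDiff_posPart_rpow hq).comp_contDiffOn (contDiffOn_const.sub hv.1)
  have hζC : ContDiffOn ℝ 1 (fun x : E => r ^ 2 - ‖x‖ ^ 2) (ball 0 2) :=
    (contDiff_const.sub (contDiff_norm_sq ℝ)).contDiffOn
  have hθ : 0 < (p - 1) / p := div_pos (by linarith) hp0
  have hθ1 : (p - 1) / p ≤ 1 := by rw [div_le_one hp0]; linarith
  set w : E → ℝ := S.indicator 1 with hw
  have hMeq : ∀ x : E, (w x * ‖-(2 • innerSL ℝ x)‖) ^ p = S.indicator (fun x => (2 * ‖x‖) ^ p) x := by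
    intro x
    rw [norm_neg_two_smul_innerSL]
    by_cases hx : x ∈ S
    · simp [hw, hx]
    · simp [hw, hx, Real.zero_rpow hp0.ne']
  have hMint : IntegrableOn (fun x : E => (w x * ‖-(2 • innerSL ℝ x)‖) ^ p) (ball 0 r) := by
    simp_rw [hMeq]
    refine IntegrableOn.of_bound measure_ball_lt_top
      (((by fun_prop : Measurable fun x : E => 2 * ‖x‖).pow_const p).indicator
        hSm).aestronglyMeasurable ((2 : ℝ) ^ p) ?_
    filter_upwards [ae_restrict_mem measurableSet_ball] with x hx
    refine (norm_indicator_le_norm_self _ _).trans ?_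
    rw [Real.norm_of_nonneg (by positivity)]
    have := mem_ball_zero_iff.1 hx
    gcongr
    linarith
  have hUr : ball (0 : E) 2 ∩ {x | 0 < r ^ 2 - ‖x‖ ^ 2} = ball 0 r := by
    rw [hζpos, inter_eq_right.2 hbr]
  obtain ⟨hQi, hQ⟩ := hv.caccioppoli_indicator hp isOpen_ball
    (isCompact_closedBall (0 : E) r) (closedBall_subset_ball (by linarith))
    (ζ := fun x => r ^ 2 - ‖x‖ ^ 2) (G := fun x => s x ^ (2 : ℝ))
    (g := fun x => 2 * s x ^ ((2 : ℝ) - 1)) (w := w) (ζ' := fun x => -(2 • innerSL ℝ x))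
    hζC (hsC 2 one_lt_two)
    (fun x _ hxK => Or.inl (by
      rw [mem_closedBall_zero_iff, not_le] at hxK
      nlinarith))
    (fun x _ => hasFDerivAt_const_sub_norm_sq _ x)
    (hsd 2 one_lt_two)
    (fun x hx => Real.rpow_nonneg (hs0 x) _)
    (fun x hx => mul_nonneg zero_le_two (Real.rpow_nonneg (hs0 x) _))
    (fun x hx => indicator_nonneg (fun _ _ => zero_le_one) _)
    (fun x hx _ => by
      by_cases hxk : v x < k
      · have hxS : x ∈ S := ⟨hx, hxk⟩
        rw [hw, indicator_of_mem hxS, Pi.one_apply, one_mul]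
        have h0 := hs0 x
        have h1 := hs1 x hx
        rw [show (2 : ℝ) - 1 = 1 by norm_num, Real.rpow_one, Real.rpow_two]
        rcases le_total (2 * s x) 1 with h | h
        · have h2 := Real.rpow_le_rpow_of_exponent_ge' (by positivity) h hθ.le hθ1
          rw [Real.rpow_one] at h2
          nlinarith
        · have h2 := Real.one_le_rpow h hθ.le
          nlinarith
      · rw [hsA x (not_lt.1 hxk), Real.zero_rpow two_ne_zero, hw,
          indicator_of_notMem fun h => hxk h.2, zero_mul])
    (by
      simp only [show (2 : ℝ) - 1 = 1 by norm_num, Real.rpow_one]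
      exact continuousOn_const.mul ((continuousOn_const.sub hvc).sup continuousOn_const))
    (by rw [hUr]; exact hMint)
  rw [hUr] at hQ
  have hM : ∫ x in ball (0 : E) r, (w x * ‖-(2 • innerSL ℝ x)‖) ^ p ≤ 2 ^ p * volume.real A := by
    calc _ ≤ ∫ x in ball (0 : E) r, S.indicator (fun _ => (2 : ℝ) ^ p) x := by
          refine setIntegral_mono_on hMint ((integrableOn_const measure_ball_lt_top.ne).indicator
            hSm) measurableSet_ball fun x hx => ?_
          rw [hMeq]
          refine indicator_le_indicator ?_
          have := mem_ball_zero_iff.1 hx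
          gcongr
          linarith
      _ = _ := by
          rw [setIntegral_indicator hSm, setIntegral_const, ← hAS, smul_eq_mul, mul_comm]
  set Q : E → ℝ := fun x => (max (r ^ 2 - ‖x‖ ^ 2) 0) ^ p * (2 * s x ^ ((2 : ℝ) - 1)) *
    ‖gradient v x‖ ^ p with hQdef
  set φ : E → ℝ := fun x => (max (r ^ 2 - ‖x‖ ^ 2) 0) ^ p * s x ^ (p + 1) with hφ
  obtain ⟨b1, b2, b3⟩ := contDiff_indicator_of_isCompact isOpen_ball (isCompact_closedBall (0 : E) r)
    (closedBall_subset_ball (by linarith)) (φ := φ)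
    (((contDiff_posPart_rpow hp).comp_contDiffOn hζC).mul (hsC (p + 1) (by linarith)))
    (fun x _ hxK => by
      rw [mem_closedBall_zero_iff, not_le] at hxK
      rw [hφ]
      simp only
      rw [max_eq_right (by nlinarith), Real.zero_rpow hp0.ne', zero_mul])
  set h : E → ℝ := (ball (0 : E) 2).indicator φ with hh
  have hQ0 : ∀ x, 0 ≤ Q x := fun x => by
    have := hs0 x
    simp only [hQdef]
    positivity
  have hfd : ∀ x, ‖fderiv ℝ h x‖ ≤
      A.indicator (fun _ => 3 * p + 1) x + (ball (0 : E) 2).indicator (fun x => (p + 1) / 2 * Q x) x := by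
    intro x
    by_cases hxU : x ∈ ball (0 : E) 2
    swap
    · have : fderiv ℝ h x = 0 := by
        have hx : x ∉ tsupport h := fun hx => hxU (closedBall_subset_ball (by linarith) (b3 hx))
        exact image_eq_zero_of_notMem_tsupport fun h' => hx (tsupport_fderiv_subset ℝ h')
      rw [this, norm_zero, indicator_of_notMem hxU, add_zero]
      exact indicator_nonneg (fun _ _ => by positivity) _
    rw [indicator_of_mem hxU]
    have hx2 := hQ0 x
    have heq : h =ᶠ[𝓝 x] φ := by
      filter_upwards [isOpen_ball.mem_nhds hxU] with z hz using indicator_of_mem hz _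
    have hd := (((hasDerivAt_posPart_rpow hp (r ^ 2 - ‖x‖ ^ 2)).comp_hasFDerivAt x
      (hasFDerivAt_const_sub_norm_sq _ x)).mul (hsd (p + 1) (by linarith) x hxU)).congr_of_eventuallyEq heq
    rw [hd.fderiv]
    set Z := max (r ^ 2 - ‖x‖ ^ 2) 0 with hZ
    have hZ0 : 0 ≤ Z := le_max_right _ _
    have hZ1 : Z ≤ 1 := max_le (by nlinarith [norm_nonneg x]) zero_le_one
    by_cases hxA : x ∈ A
    · rw [indicator_of_mem hxA]
      have hs01 := hs1 x hxU
      have hs00 := hs0 x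
      set t := ‖gradient v x‖
      have ht0 : 0 ≤ t := norm_nonneg _
      have hx1 : ‖x‖ ≤ 1 := (mem_ball_zero_iff.1 hxA.1).le.trans hr
      have h2 : t ≤ 1 + t ^ p := by
        rcases le_total t 1 with h | h
        · have : 0 ≤ t ^ p := by positivity
          linarith
        · have := Real.self_le_rpow_of_one_le h hp.le
          linarith
      have hZp : Z ^ p ≤ 1 := Real.rpow_le_one hZ0 hZ1 hp0.le
      have hZp0 : 0 ≤ Z ^ p := by positivity
      have hZp' : Z ^ (p - 1) ≤ 1 := Real.rpow_le_one hZ0 hZ1 (by linarith)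
      have hZp0' : 0 ≤ Z ^ (p - 1) := by positivity
      have hsp : s x ^ p ≤ s x := by
        simpa using Real.rpow_le_rpow_of_exponent_ge' hs00 hs01 zero_le_one hp.le
      have hsp0 : 0 ≤ s x ^ p := by positivity
      have hsp' : s x ^ (p + 1) ≤ 1 := Real.rpow_le_one hs00 hs01 (by linarith)
      have hsp0' : 0 ≤ s x ^ (p + 1) := by positivity
      have hQx : Q x = Z ^ p * (2 * s x) * t ^ p := by
        rw [hQdef]
        simp only [show (2 : ℝ) - 1 = 1 by norm_num, Real.rpow_one, hZ, t]
      refine (norm_add_le _ _).trans ?_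
      rw [norm_smul, norm_smul, norm_smul, norm_smul, norm_neg_two_smul_innerSL, ← norm_gradient]
      simp only [Function.comp_apply, ← hZ, norm_neg, add_sub_cancel_right]
      rw [Real.norm_of_nonneg hZp0, Real.norm_of_nonneg hsp0',
        Real.norm_of_nonneg (show 0 ≤ (p + 1) * s x ^ p by positivity),
        Real.norm_of_nonneg (show 0 ≤ p * Z ^ (p - 1) by positivity), hQx]
      have i1 : Z ^ p * ((p + 1) * s x ^ p * t) ≤ (p + 1) * (1 + Z ^ p * s x * t ^ p) := by
        have j1 : s x ^ p * t ≤ s x * (1 + t ^ p) := by gcongr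
        have j2 : Z ^ p * (s x * (1 + t ^ p)) ≤ 1 + Z ^ p * s x * t ^ p := by
          have : Z ^ p * s x ≤ 1 := mul_le_one₀ hZp hs00 hs01
          nlinarith
        calc _ = (p + 1) * (Z ^ p * (s x ^ p * t)) := by ring
          _ ≤ (p + 1) * (Z ^ p * (s x * (1 + t ^ p))) := by gcongr
          _ ≤ _ := by gcongr
      have i2 : s x ^ (p + 1) * (p * Z ^ (p - 1) * (2 * ‖x‖)) ≤ 2 * p := by
        calc _ ≤ 1 * (p * 1 * (2 * 1)) := by gcongr
          _ = _ := by ring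
      linarith
    · rw [indicator_of_notMem hxA, zero_add]
      refine le_of_eq_of_le ?_ (show (0 : ℝ) ≤ (p + 1) / 2 * Q x by positivity)
      rw [norm_eq_zero]
      by_cases hxr : x ∈ ball (0 : E) r
      · have : s x = 0 := hsA x (not_lt.1 fun h' => hxA ⟨hxr, h'⟩)
        simp [this, Real.zero_rpow (show p + 1 ≠ 0 by positivity), Real.zero_rpow hp0.ne']
      · have : Z = 0 := max_eq_right (by
          rw [← hζpos] at hxr; exact not_lt.1 hxr)
        simp [← hZ, this, Real.zero_rpow (show p - 1 ≠ 0 by linarith), Real.zero_rpow hp0.ne']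
  have hgrad : ∫⁻ x, ‖fderiv ℝ h x‖ₑ ≤ ENNReal.ofReal (C1 * volume.real A) := by
    have hi1 : Integrable (A.indicator fun _ : E => 3 * p + 1) :=
      (integrableOn_const hAfin).integrable_indicator hAm
    have hi2 : Integrable ((ball (0 : E) 2).indicator fun x => (p + 1) / 2 * Q x) :=
      (integrable_indicator_iff measurableSet_ball).2 (hQi.const_mul _)
    calc _ ≤ ∫⁻ x, ENNReal.ofReal (A.indicator (fun _ => 3 * p + 1) x +
            (ball (0 : E) 2).indicator (fun x => (p + 1) / 2 * Q x) x) := by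
          refine lintegral_mono fun x => ?_
          rw [← ofReal_norm]
          exact ENNReal.ofReal_le_ofReal (hfd x)
      _ = ENNReal.ofReal (∫ x, (A.indicator (fun _ => 3 * p + 1) x +
            (ball (0 : E) 2).indicator (fun x => (p + 1) / 2 * Q x) x)) := by
          exact (ofReal_integral_eq_lintegral_ofReal (hi1.add hi2)
            (ae_of_all _ fun x => (norm_nonneg _).trans (hfd x))).symm
      _ ≤ _ := by
          refine ENNReal.ofReal_le_ofReal ?_
          rw [integral_add hi1 hi2, integral_indicator hAm, integral_indicator measurableSet_ball,
            setIntegral_const, integral_const_mul, smul_eq_mul]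
          have h1 : ∫ x in ball (0 : E) 2, Q x ≤ 2 * (2 * p) ^ p * (2 ^ p * volume.real A) :=
            hQ.trans (by gcongr)
          have h2 : (p + 1) / 2 * ∫ x in ball (0 : E) 2, Q x ≤
            (p + 1) / 2 * (2 * (2 * p) ^ p * (2 ^ p * volume.real A)) := by gcongr
          rw [hC1]
          linarith
  set m : ℝ := (k - k') ^ (p + 1) * (r ^ 2 - r' ^ 2) ^ p with hm
  have hk0 : 0 < k - k' := by linarith
  have hrr0 : 0 < r ^ 2 - r' ^ 2 := by nlinarith
  have hm0 : 0 < m := by positivity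
  set A' : Set E := ball (0 : E) r' ∩ {x | v x < k'} with hA'
  have hA'U : A' ⊆ ball 0 2 := fun x hx => ball_subset_ball (by linarith) hx.1
  have hA'fin : volume A' ≠ ⊤ := measure_ne_top_of_subset inter_subset_left measure_ball_lt_top.ne
  have hhm : ∀ x ∈ A', m ≤ h x := by
    intro x hx
    rw [hh, indicator_of_mem (hA'U hx), hφ, hm, mul_comm]
    have h1 := mem_ball_zero_iff.1 hx.1
    have h2 : v x < k' := hx.2
    simp only
    gcongr
    · exact le_max_of_le_left (by nlinarith [norm_nonneg x])
    · exact le_max_of_le_left (by linarith)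
  have hche : ENNReal.ofReal m ^ κ * volume A' ≤ ∫⁻ x, ‖h x‖ₑ ^ κ := by
    refine (mul_le_mul_right (measure_mono fun x hx => ?_) _).trans (mul_meas_ge_le_lintegral₀ (b1.continuous.measurable.enorm.pow_const κ).aemeasurable _)
    rw [mem_ofPred_eq]
    gcongr
    rw [← ofReal_norm]
    exact ENNReal.ofReal_le_ofReal ((hhm x hx).trans (le_abs_self _))
  have hsob := lintegral_pow_le_pow_lintegral_fderiv (volume : Measure E) b1 b2 hκ
  have hfinal : ENNReal.ofReal m ^ κ * volume A' ≤ c * ENNReal.ofReal (C1 * volume.real A) ^ κ :=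
    hche.trans (hsob.trans (by gcongr))
  rw [ENNReal.ofReal_rpow_of_nonneg hm0.le hκ0.le,
    ENNReal.ofReal_rpow_of_nonneg (by positivity) hκ0.le] at hfinal
  have hreal := ENNReal.toReal_mono (by finiteness) hfinal
  rw [ENNReal.toReal_mul, ENNReal.toReal_mul, ENNReal.toReal_ofReal (by positivity),
    ENNReal.toReal_ofReal (by positivity), ENNReal.coe_toReal] at hreal
  have hc1 : ((c + 1 : ℝ) ^ κ⁻¹ * C1 * volume.real A) ^ κ = (c + 1) * (C1 * volume.real A) ^ κ := by
    rw [mul_assoc, Real.mul_rpow (by positivity) (by positivity), ← Real.rpow_mul (by positivity),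
      inv_mul_cancel₀ hκ0.ne', Real.rpow_one]
  rw [hc1, mul_comm]
  refine hreal.trans ?_
  gcongr
  linarith

end PHarmonic

section PHarmonic

variable {E : Type*} [NormedAddCommGroup E] [InnerProductSpace ℝ E] [FiniteDimensional ℝ E]
  [MeasurableSpace E] [BorelSpace E]

theorem exists_half_le_of_volume_sublevel_le {p : ℝ} (hp : 1 < p) (hE : 2 ≤ Module.finrank ℝ E) :
    ∃ ε : ℝ, 0 < ε ∧ ∀ v : E → ℝ, IsPHarmonicOn p (ball 0 2) v → (∀ x ∈ ball (0 : E) 2, 0 ≤ v x) →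
      volume.real (ball (0 : E) 1 ∩ {x | v x < 1}) ≤ ε → ∀ x ∈ ball (0 : E) (1 / 2), 1 / 2 ≤ v x := by
  have hκ : Real.HolderConjugate (Module.finrank ℝ E) (Real.conjExponent (Module.finrank ℝ E)) :=
    Real.HolderConjugate.conjExponent (by exact_mod_cast hE)
  set κ := Real.conjExponent (Module.finrank ℝ E)
  have hκ1 : 1 < κ := hκ.symm.lt
  have hκ0 : 0 < κ := by linarith
  obtain ⟨C, hC, hstep⟩ := exists_deGiorgi_step hp hκ
  set b : ℝ := 2 ^ (2 * p + 1) with hb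
  have hb1 : 1 < b := Real.one_lt_rpow one_lt_two (by linarith)
  have hb0 : 0 < b := by linarith
  obtain ⟨ε, hε, hseq⟩ := tendsto_zero_of_le_mul_pow_rpow hκ1 (show 0 < C * b ^ 2 by positivity) hb1
  refine ⟨ε, hε, fun v hv hv0 hvol x hx => ?_⟩
  set r : ℕ → ℝ := fun j => 1 / 2 + (1 / 2) ^ (j + 1) with hr
  set a : ℕ → ℝ := fun j => volume.real (ball (0 : E) (r j) ∩ {x | v x < r j}) with ha
  have hlim : Tendsto a atTop (𝓝 0) := by
    refine hseq a (fun j => measureReal_nonneg) ?_ fun j => ?_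
    · have : r 0 = 1 := by norm_num [hr]
      rw [ha]
      simpa only [this] using hvol
    · have hd : r j - r (j + 1) = (1 / 2) ^ (j + 2) := by
        simp only [hr]; ring
      have hd0 : 0 < r j - r (j + 1) := by rw [hd]; positivity
      have hr1 : r j ≤ 1 := by
        have : (1 / 2 : ℝ) ^ (j + 1) ≤ 1 / 2 := by
          rw [pow_succ]
          have : (1 / 2 : ℝ) ^ j ≤ 1 := pow_le_one₀ (by norm_num) (by norm_num)
          linarith
        simp only [hr]; linarith
      have hrh : ∀ j, 1 / 2 ≤ r j := fun j => by
        simp only [hr]; have : (0 : ℝ) < (1 / 2) ^ (j + 1) := by positivity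
        linarith
      have h1 := hstep v hv hv0 (r (j + 1)) (r j) (r (j + 1)) (r j) (by linarith [hrh (j + 1)])
        (by linarith) hr1 (by linarith) hr1
      have h2 : (b ^ (j + 2))⁻¹ ≤
          (r j - r (j + 1)) ^ (p + 1) * (r j ^ 2 - r (j + 1) ^ 2) ^ p := by
        have h3 : r j - r (j + 1) ≤ r j ^ 2 - r (j + 1) ^ 2 := by
          nlinarith [hrh j, hrh (j + 1)]
        calc (b ^ (j + 2))⁻¹ = (r j - r (j + 1)) ^ (p + 1) * (r j - r (j + 1)) ^ p := by
              rw [← Real.rpow_add hd0, hd, hb, ← Real.rpow_natCast, ← Real.rpow_natCast,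
                ← Real.rpow_mul two_pos.le, ← Real.rpow_mul (by norm_num), one_div,
                Real.inv_rpow two_pos.le]
              congr 2
              ring
          _ ≤ _ := by gcongr
      have h4 : a (j + 1) * ((b ^ (j + 2))⁻¹) ^ κ ≤ (C * a j) ^ κ := by
        refine le_trans ?_ h1
        gcongr
      rw [Real.inv_rpow (by positivity), ← div_eq_mul_inv, div_le_iff₀ (by positivity),
        ← Real.mul_rpow (mul_nonneg hC.le measureReal_nonneg) (by positivity)] at h4
      refine h4.trans (le_of_eq ?_)
      congr 1
      ring
  have hvc : ContinuousOn v (ball 0 2) := hv.1.continuousOn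
  have hopen : IsOpen (ball (0 : E) (1 / 2) ∩ {x | v x < 1 / 2}) :=
    (hvc.mono (ball_subset_ball (by norm_num))).isOpen_inter_preimage isOpen_ball isOpen_Iio
  have hle : ∀ j, volume.real (ball (0 : E) (1 / 2) ∩ {x | v x < 1 / 2}) ≤ a j := by
    intro j
    have : 1 / 2 ≤ r j := by
      simp only [hr]; have : (0 : ℝ) < (1 / 2) ^ (j + 1) := by positivity
      linarith
    refine measureReal_mono (inter_subset_inter (ball_subset_ball this) fun z hz => ?_)
      (measure_ne_top_of_subset inter_subset_left measure_ball_lt_top.ne)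
    exact lt_of_lt_of_le hz this
  have hzero : volume.real (ball (0 : E) (1 / 2) ∩ {x | v x < 1 / 2}) = 0 :=
    le_antisymm (ge_of_tendsto' hlim hle) measureReal_nonneg
  rw [measureReal_eq_zero_iff (measure_ne_top_of_subset inter_subset_left measure_ball_lt_top.ne),
    hopen.measure_eq_zero_iff volume] at hzero
  by_contra hcon
  exact notMem_empty x (hzero ▸ ⟨hx, not_le.1 hcon⟩)

theorem exists_le_of_volume_superlevel_ge_unit {p : ℝ} (hp : 1 < p) (hE : 2 ≤ Module.finrank ℝ E)
    {η : ℝ} (hη : 0 < η) :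
    ∃ c : ℝ, 0 < c ∧ ∀ v : E → ℝ, IsPHarmonicOn p (ball 0 2) v →
      (∀ x ∈ ball (0 : E) 2, 0 < v x) → η ≤ volume.real (ball (0 : E) 1 ∩ {x | 1 ≤ v x}) →
      ∀ x ∈ ball (0 : E) (1 / 2), c ≤ v x := by
  obtain ⟨ε, hε, hdg⟩ := exists_half_le_of_volume_sublevel_le hp hE
  obtain ⟨C, hC, hlog⟩ := exists_lintegral_fderiv_log_le (E := E) hp
  set V := volume.real (ball (0 : E) 2)
  have hV : 0 < V := by
    refine ENNReal.toReal_pos ?_ measure_ball_lt_top.ne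
    exact (measure_ball_pos _ _ two_pos).ne'
  set s : ℝ := 2 * V * C / (ε * η) with hs
  have hs0 : 0 < s := by positivity
  refine ⟨Real.exp (-s) / 2, by positivity, fun v hv hv0 hvol x hx => ?_⟩
  have hvc : ContinuousOn v (ball 0 2) := hv.1.continuousOn
  have hsub : ball (0 : E) 1 ⊆ ball 0 2 := ball_subset_ball (by norm_num)
  have hm : ∀ t : ℝ, MeasurableSet (ball (0 : E) 1 ∩ {x | v x < t}) := fun t =>
    ((hvc.mono hsub).isOpen_inter_preimage isOpen_ball isOpen_Iio).measurableSet
  have hmF : MeasurableSet (ball (0 : E) 1 ∩ {x | 1 ≤ v x}) := by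
    have : ball (0 : E) 1 ∩ {x | 1 ≤ v x} = ball 0 1 \ (ball (0 : E) 1 ∩ {x | v x < 1}) := by
      ext z
      simp only [mem_inter_iff, mem_ofPred_eq, Set.mem_sdiff, not_and, not_lt]
      tauto
    rw [this]
    exact measurableSet_ball.diff (hm 1)
  have hpo := mul_volume_mul_volume_le_lintegral_fderiv (f := fun x => -Real.log (v x)) (s := s)
    ((hv.1.mono hsub).log fun z hz => (hv0 z (hsub hz)).ne').neg (hm (Real.exp (-s))) hmF
    inter_subset_left inter_subset_left
    (fun z hz => by
      have h1 := hv0 z (hsub hz.1)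
      have h2 := Real.log_le_log h1 (le_of_lt hz.2)
      rw [Real.log_exp] at h2
      linarith)
    (fun z hz => by
      have := Real.log_nonneg hz.2
      linarith)
  have hgr : ∫⁻ x in ball (0 : E) 1, ‖fderiv ℝ (fun x => -Real.log (v x)) x‖ₑ ≤
      ENNReal.ofReal C := by
    simp only [fderiv_fun_neg, enorm_neg]
    exact hlog v hv hv0
  have hpo2 := hpo.trans (mul_le_mul_right hgr _)
  have hVtop : volume (ball (0 : E) 2) ≠ ⊤ := measure_ball_lt_top.ne
  have hpo3 := ENNReal.toReal_mono (by finiteness) hpo2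
  simp only [ENNReal.toReal_mul, ENNReal.toReal_ofReal hs0.le, ENNReal.toReal_ofReal hC.le,
    ENNReal.toReal_ofNat] at hpo3
  have hsmall : volume.real (ball (0 : E) 1 ∩ {x | v x < Real.exp (-s)}) ≤ ε := by
    change s * volume.real (ball (0 : E) 1 ∩ {x | v x < Real.exp (-s)}) *
      volume.real (ball (0 : E) 1 ∩ {x | 1 ≤ v x}) ≤ 2 * V * C at hpo3
    set α := volume.real (ball (0 : E) 1 ∩ {x | v x < Real.exp (-s)})
    have hα : 0 ≤ α := measureReal_nonneg
    have h1 : s * α * η ≤ 2 * V * C := le_trans (by gcongr) hpo3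
    have h2 : 2 * V * C = s * ε * η := by rw [hs]; field_simp
    rw [h2] at h1
    have := le_of_mul_le_mul_right h1 hη
    exact le_of_mul_le_mul_left this hs0
  have hsc := hv.comp_homothety isOpen_ball (Real.exp s) 0 0 one_pos
  simp only [one_smul, zero_add, add_zero] at hsc
  have hlt : ∀ z, Real.exp s * v z < 1 ↔ v z < Real.exp (-s) := fun z => by
    rw [Real.exp_neg, ← one_div, lt_div_iff₀' (Real.exp_pos s)]
  have := hdg (fun x => Real.exp s * v x) hsc (fun z hz => by have := hv0 z hz; positivity)
    (by simpa only [hlt] using hsmall) x hx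
  rw [Real.exp_neg, inv_eq_one_div, div_div, div_le_iff₀ (by positivity)]
  linarith

theorem volume_real_preimage_homothety (y : E) {ρ : ℝ} (hρ : 0 < ρ) (s : Set E) :
    volume.real ((fun x => y + ρ • x) ⁻¹' s) =
      (ρ ^ Module.finrank ℝ E)⁻¹ * volume.real s := by
  have h1 : (fun x => y + ρ • x) ⁻¹' s = (ρ • ·) ⁻¹' ((y + ·) ⁻¹' s) := rfl
  rw [h1, measureReal_def, Measure.addHaar_preimage_smul _ hρ.ne', measure_preimage_add,
    ENNReal.toReal_mul, ENNReal.toReal_ofReal (abs_nonneg _), abs_of_pos (by positivity)]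
  rfl

theorem preimage_homothety_ball (y : E) {ρ : ℝ} (hρ : 0 < ρ) (a : ℝ) :
    (fun x => y + ρ • x) ⁻¹' ball y (ρ * a) = ball 0 a := by
  ext x
  rw [mem_preimage, mem_ball, dist_self_add_left, norm_smul, Real.norm_of_nonneg hρ.le,
    mul_lt_mul_iff_right₀ hρ, mem_ball_zero_iff]

/-- A positive `p`-harmonic function which is at least `t` on a fixed fraction of a ball is at
least a fixed multiple of `t` on the concentric ball of half the radius. -/
theorem exists_mul_le_of_volume_superlevel_ge {p : ℝ} (hp : 1 < p) (hE : 2 ≤ Module.finrank ℝ E) :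
    ∃ c : ℝ, 0 < c ∧ c < 1 ∧ ∀ (v : E → ℝ) (y : E) (ρ t : ℝ), 0 < ρ → 0 < t →
      IsPHarmonicOn p (ball y (2 * ρ)) v → (∀ x ∈ ball y (2 * ρ), 0 < v x) →
      (1 / 4) ^ Module.finrank ℝ E * volume.real (ball y ρ) ≤
        volume.real (ball y ρ ∩ {x | t ≤ v x}) →
      ∀ x ∈ ball y (ρ / 2), c * t ≤ v x := by
  have hV : 0 < volume.real (ball (0 : E) 1) :=
    ENNReal.toReal_pos (measure_ball_pos _ _ one_pos).ne' measure_ball_lt_top.ne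
  obtain ⟨c, hc, H⟩ := exists_le_of_volume_superlevel_ge_unit hp hE
    (show 0 < (1 / 4) ^ Module.finrank ℝ E * volume.real (ball (0 : E) 1) by positivity)
  refine ⟨min c (1 / 2), by positivity, by
    have := min_le_right c (1 / 2); linarith, fun v y ρ t hρ ht hv hv0 hvol x hx => ?_⟩
  have hsc := hv.comp_homothety isOpen_ball t⁻¹ 0 y hρ
  have hdom : {x : E | y + ρ • x ∈ ball y (2 * ρ)} = ball 0 2 := by
    rw [mul_comm]; exact preimage_homothety_ball y hρ 2
  rw [hdom] at hsc
  simp only [add_zero] at hsc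
  have hb1 : (fun x => y + ρ • x) ⁻¹' ball y ρ = ball 0 1 := by
    simpa using preimage_homothety_ball y hρ 1
  have hvol2 : (1 / 4) ^ Module.finrank ℝ E * volume.real (ball (0 : E) 1) ≤
      volume.real (ball (0 : E) 1 ∩ {x | 1 ≤ t⁻¹ * v (y + ρ • x)}) := by
    have h1 := volume_real_preimage_homothety y hρ (ball y ρ)
    have h2 := volume_real_preimage_homothety y hρ (ball y ρ ∩ {x | t ≤ v x})
    rw [preimage_inter, hb1] at h2
    rw [hb1] at h1
    have h3 : {x : E | 1 ≤ t⁻¹ * v (y + ρ • x)} = (fun x => y + ρ • x) ⁻¹' {x | t ≤ v x} := by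
      ext z
      rw [mem_ofPred_eq, mem_preimage, mem_ofPred_eq, inv_mul_eq_div, one_le_div ht]
    rw [h3, h1, h2, mul_left_comm]
    gcongr
  set x' := ρ⁻¹ • (x - y) with hx'
  have hxx : y + ρ • x' = x := by
    rw [hx', smul_smul, mul_inv_cancel₀ hρ.ne', one_smul, add_sub_cancel]
  have hx'b : x' ∈ ball (0 : E) (1 / 2) := by
    rw [← preimage_homothety_ball y hρ, mem_preimage, hxx, mul_one_div]
    exact hx
  have := H _ hsc (fun z hz => mul_pos (inv_pos.2 ht) (hv0 _ (by
    rw [← hdom] at hz; exact hz))) hvol2 x' hx'b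
  rw [hxx, inv_mul_eq_div, le_div_iff₀ ht] at this
  exact le_trans (by gcongr; exact min_le_left _ _) this

/-- Expansion of positivity. -/
theorem exists_mul_le_on_double_ball {p : ℝ} (hp : 1 < p) (hE : 2 ≤ Module.finrank ℝ E) :
    ∃ c : ℝ, 0 < c ∧ c < 1 ∧ (∀ (v : E → ℝ) (y : E) (r t : ℝ), 0 < r → 0 < t →
      IsPHarmonicOn p (ball y (8 * r)) v → (∀ x ∈ ball y (8 * r), 0 < v x) →
      (∀ x ∈ ball y r, t ≤ v x) → ∀ x ∈ ball y (2 * r), c * t ≤ v x) ∧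
    (∀ (v : E → ℝ) (y : E) (ρ t : ℝ), 0 < ρ → 0 < t →
      IsPHarmonicOn p (ball y (2 * ρ)) v → (∀ x ∈ ball y (2 * ρ), 0 < v x) →
      volume.real (ball y ρ) ≤ 2 * volume.real (ball y ρ ∩ {x | t ≤ v x}) →
      ∀ x ∈ ball y (ρ / 2), c * t ≤ v x) := by
  obtain ⟨c, hc, hc1, H⟩ := exists_mul_le_of_volume_superlevel_ge hp hE
  refine ⟨c, hc, hc1, fun v y r t hr ht hv hv0 h x hx => ?_, fun v y ρ t hρ ht hv hv0 h => ?_⟩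
  · refine H v y (4 * r) t (by positivity) ht (by convert hv using 2; ring)
      (fun x hx => hv0 x (by convert hx using 2; ring)) ?_ x (by convert hx using 2; ring)
    have h1 : volume.real (ball y r) = (1 / 4) ^ Module.finrank ℝ E * volume.real (ball y (4 * r)) := by
      rw [measureReal_def, measureReal_def, Measure.addHaar_ball_of_pos _ _ hr,
        Measure.addHaar_ball_of_pos _ y (show 0 < 4 * r by positivity), ENNReal.toReal_mul, ENNReal.toReal_mul,
        ENNReal.toReal_ofReal (by positivity), ENNReal.toReal_ofReal (by positivity), ← mul_assoc,
        ← mul_pow]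
      congr 2
      ring
    rw [← h1]
    refine measureReal_mono (fun z hz => ⟨ball_subset_ball (by linarith) hz, h z hz⟩)
      (measure_ne_top_of_subset inter_subset_left measure_ball_lt_top.ne)
  · refine H v y ρ t hρ ht hv hv0 ?_
    have h1 : (1 / 4 : ℝ) ^ Module.finrank ℝ E ≤ 1 / 2 := by
      calc (1 / 4 : ℝ) ^ Module.finrank ℝ E ≤ (1 / 4) ^ 1 :=
            pow_le_pow_of_le_one (by norm_num) (by norm_num) (by omega)
        _ ≤ _ := by norm_num
    calc _ ≤ 1 / 2 * volume.real (ball y ρ) := by gcongr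
      _ ≤ _ := by linarith

end PHarmonic

section PHarmonic

variable {E : Type*} [NormedAddCommGroup E] [InnerProductSpace ℝ E] [FiniteDimensional ℝ E]
  [MeasurableSpace E] [BorelSpace E]

/-- Lower bounds for `v` on a ball inside `Ω` pass, up to the factor `c`, to the double ball. -/
def ExpandsPositivity (c : ℝ) (Ω : Set E) (v : E → ℝ) : Prop :=
  ∀ (y : E) (r t : ℝ), 0 < r → 0 < t → ball y (8 * r) ⊆ Ω → (∀ x ∈ ball y r, t ≤ v x) →
    ∀ x ∈ ball y (2 * r), c * t ≤ v x

theorem ExpandsPositivity.segment {c : ℝ} (hc : 0 < c) {v : E → ℝ} {Ω : Set E}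
    (H : ExpandsPositivity c Ω v) {a b : E} {ρ t : ℝ} (hρ : 0 < ρ) (ht : 0 < t) {M : ℕ}
    (hM : 0 < M) (hab : ‖b - a‖ ≤ M * ρ)
    (hseg : ∀ s ∈ Icc (0 : ℝ) 1, ball (a + s • (b - a)) (8 * ρ) ⊆ Ω)
    (h : ∀ x ∈ ball a ρ, t ≤ v x) : ∀ x ∈ ball b ρ, c ^ M * t ≤ v x := by
  have hM0 : (0 : ℝ) < M := by exact_mod_cast hM
  have key : ∀ i : ℕ, i ≤ M → ∀ x ∈ ball (a + ((i : ℝ) / M) • (b - a)) ρ, c ^ i * t ≤ v x := by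
    intro i
    induction i with
    | zero => intro _ x hx; simpa using h x (by simpa using hx)
    | succ i ih =>
      intro hi x hx
      have hiM : (i : ℝ) ≤ M := by exact_mod_cast (by omega : i ≤ M)
      have := H (a + ((i : ℝ) / M) • (b - a)) ρ (c ^ i * t) hρ (by positivity)
        (hseg _ ⟨by positivity, by rw [div_le_one hM0]; exact hiM⟩) (ih (by omega)) x ?_
      · rw [pow_succ']; linarith
      rw [mem_ball] at hx ⊢
      have h1 : dist (a + ((i + 1 : ℕ) / M : ℝ) • (b - a)) (a + ((i : ℝ) / M) • (b - a)) ≤ ρ := by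
        rw [dist_eq_norm, add_sub_add_left_eq_sub, ← sub_smul, norm_smul, ← sub_div]
        push_cast
        rw [add_sub_cancel_left, Real.norm_of_nonneg (by positivity), one_div,
          inv_mul_le_iff₀ hM0]
        exact hab
      linarith [dist_triangle x (a + ((i + 1 : ℕ) / M : ℝ) • (b - a)) (a + ((i : ℝ) / M) • (b - a))]
  have := key M le_rfl
  rw [div_self hM0.ne', one_smul, add_sub_cancel] at this
  exact this

theorem ExpandsPositivity.doubling {c : ℝ} (hc : 0 < c) {v : E → ℝ} {Ω : Set E}
    (H : ExpandsPositivity c Ω v) {y : E} {ρ t : ℝ} (hρ : 0 < ρ) (ht : 0 < t)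
    (hy : ball y (8 * ρ) ⊆ Ω) (n : ℕ) (h : ∀ x ∈ ball y (ρ * (1 / 2) ^ n), t ≤ v x) :
    ∀ x ∈ ball y ρ, c ^ n * t ≤ v x := by
  induction n generalizing t with
  | zero => simpa using h
  | succ n ih =>
    have h1 := H y (ρ * (1 / 2) ^ (n + 1)) t (by positivity) ht
      ((ball_subset_ball (by
        have : (1 / 2 : ℝ) ^ (n + 1) ≤ 1 := pow_le_one₀ (by norm_num) (by norm_num)
        nlinarith)).trans hy) h
    have h2 : 2 * (ρ * (1 / 2 : ℝ) ^ (n + 1)) = ρ * (1 / 2) ^ n := by rw [pow_succ]; ring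
    rw [h2] at h1
    have := ih (t := c * t) (by positivity) h1
    intro x hx
    have := this x hx
    rw [pow_succ]; linarith

theorem exists_norm_one_inner_eq_zero (hE : 2 ≤ Module.finrank ℝ E) {y : E} (hy : y ≠ 0) (z : E) :
    ∃ w : E, ‖w‖ = 1 ∧ ⟪y, w⟫ = 0 ∧ 0 ≤ ⟪w, z⟫ := by
  obtain ⟨n, hn⟩ : ∃ n, Module.finrank ℝ E = n + 1 + 1 := ⟨Module.finrank ℝ E - 2, by omega⟩
  have : Fact (Module.finrank ℝ E = n + 1 + 1) := ⟨hn⟩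
  have h1 := Submodule.finrank_orthogonal_span_singleton (𝕜 := ℝ) hy (n := n + 1)
  have h2 : (Submodule.span ℝ {y})ᗮ ≠ ⊥ := by
    intro h
    rw [h, finrank_bot] at h1
    omega
  obtain ⟨w, hw, hw0⟩ := Submodule.exists_mem_ne_zero_of_ne_bot h2
  rw [Submodule.mem_orthogonal_singleton_iff_inner_right] at hw
  have hn : ‖‖w‖⁻¹ • w‖ = 1 := by
    rw [norm_smul, norm_inv, norm_norm, inv_mul_cancel₀ (norm_ne_zero_iff.2 hw0)]
  have hi : ⟪y, ‖w‖⁻¹ • w⟫ = 0 := by rw [inner_smul_right, hw, mul_zero]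
  rcases le_total 0 ⟪‖w‖⁻¹ • w, z⟫ with h | h
  · exact ⟨_, hn, hi, h⟩
  · exact ⟨-(‖w‖⁻¹ • w), by rw [norm_neg, hn], by rw [inner_neg_right, hi, neg_zero],
      by rw [inner_neg_left]; linarith⟩

theorem ball_subset_of_norm {z : E} {a : ℝ} (h : 1 / 2 + a ≤ ‖z‖) :
    ball z a ⊆ {x : E | 1 / 2 < ‖x‖} := by
  intro x hx
  rw [mem_ball, dist_comm] at hx
  have := norm_sub_norm_le z x
  rw [← dist_eq_norm] at this
  rw [mem_ofPred_eq]
  linarith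

theorem ExpandsPositivity.to_unit_sphere {c : ℝ} (hc : 0 < c) (hE : 2 ≤ Module.finrank ℝ E)
    {v : E → ℝ} (H : ExpandsPositivity c {x : E | 1 / 2 < ‖x‖} v) {y x : E} {t : ℝ}
    (ht : 0 < t) (hy : 7 / 8 ≤ ‖y‖) (hy' : ‖y‖ ≤ 9 / 8) (hx : ‖x‖ = 1) (n : ℕ)
    (h : ∀ z ∈ ball y (1 / 64 * (1 / 2) ^ n), t ≤ v z) : c ^ (n + 384) * t ≤ v x := by
  have hy0 : y ≠ 0 := by rintro rfl; norm_num at hy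
  obtain ⟨w, hw1, hyw, hwx⟩ := exists_norm_one_inner_eq_zero hE hy0 x
  have h1 := H.doubling hc (by norm_num) ht (ball_subset_of_norm (by linarith)) n h
  have h2 := H.segment hc (a := y) (b := w) (M := 192) (by norm_num) (by positivity) (by norm_num)
    ((norm_sub_le _ _).trans (by rw [hw1]; push_cast; linarith)) (fun s hs => by
      refine ball_subset_of_norm (abs_le_of_sq_le_sq' ?_ (norm_nonneg _)).2
      have : y + s • (w - y) = (1 - s) • y + s • w := by module
      rw [this, norm_add_sq_real, norm_smul, norm_smul, inner_smul_left, inner_smul_right, hyw, hw1,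
        mul_zero, mul_zero, mul_zero, mul_one, Real.norm_eq_abs, Real.norm_eq_abs, mul_pow, sq_abs,
        sq_abs]
      have : (7 / 8 : ℝ) ^ 2 ≤ ‖y‖ ^ 2 := by gcongr
      nlinarith [sq_nonneg (1 - s), sq_nonneg (s - 2 / 5), mul_le_mul_of_nonneg_left this (sq_nonneg (1 - s))]) h1
  have h3 := H.segment hc (a := w) (b := x) (M := 192) (by norm_num) (by positivity) (by norm_num)
    ((norm_sub_le _ _).trans (by rw [hw1, hx]; push_cast; norm_num)) (fun s hs => by
      refine ball_subset_of_norm (abs_le_of_sq_le_sq' ?_ (norm_nonneg _)).2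
      have : w + s • (x - w) = (1 - s) • w + s • x := by module
      rw [this, norm_add_sq_real, norm_smul, norm_smul, inner_smul_left, inner_smul_right, hx, hw1,
        mul_one, mul_one, Real.norm_eq_abs, Real.norm_eq_abs, sq_abs, sq_abs]
      have : 0 ≤ (1 - s) * (s * ⟪w, x⟫) := mul_nonneg (by linarith [hs.2]) (mul_nonneg hs.1 hwx)
      simp only [conj_trivial]
      nlinarith [sq_nonneg (s - 1 / 2)]) h2 x (mem_ball_self (by norm_num))
  calc c ^ (n + 384) * t = c ^ 192 * (c ^ 192 * (c ^ n * t)) := by ring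
    _ ≤ v x := h3

/-- If a positive `p`-harmonic function is much larger at a point than on the unit sphere, then it
is larger by a fixed factor at some nearby point. -/
theorem exists_growth_of_large {p : ℝ} (hp : 1 < p) (hE : 2 ≤ Module.finrank ℝ E) :
    ∃ c : ℝ, 0 < c ∧ c < 1 ∧ ∀ v : E → ℝ, IsPHarmonicOn p {x : E | 1 / 2 < ‖x‖} v →
      (∀ x : E, 1 / 2 < ‖x‖ → 0 < v x) → ∀ (x y : E) (n : ℕ), ‖x‖ = 1 → 7 / 8 ≤ ‖y‖ →
      ‖y‖ ≤ 9 / 8 → 2 * v x < c ^ (n + 385) * v y →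
      ∃ z ∈ ball y (1 / 16 * (1 / 2) ^ n), (1 + c / 4) * v y ≤ v z := by
  obtain ⟨c, hc, hc1, He, Hg⟩ := exists_mul_le_on_double_ball (E := E) hp hE
  refine ⟨c, hc, hc1, fun v hv hv0 x y n hx hy hy' hlarge => ?_⟩
  have hΩ : IsOpen {x : E | 1 / 2 < ‖x‖} := isOpen_lt continuous_const continuous_norm
  have hexp : ExpandsPositivity c {x : E | 1 / 2 < ‖x‖} v := fun y r t hr ht hb h =>
    He v y r t hr ht (hv.mono hb) (fun x hx => hv0 x (hb hx)) h
  have hy0 : 0 < v y := hv0 y (by linarith)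
  set σ : ℝ := 1 / 64 * (1 / 2) ^ n with hσ
  have hσ0 : 0 < σ := by positivity
  have hσ1 : σ ≤ 1 / 64 := by
    have : (1 / 2 : ℝ) ^ n ≤ 1 := pow_le_one₀ (by norm_num) (by norm_num)
    linarith
  have hσ4 : 1 / 16 * (1 / 2 : ℝ) ^ n = 2 * (2 * σ) := by rw [hσ]; ring
  rw [hσ4]
  have hb4 : ball y (2 * (2 * σ)) ⊆ {x : E | 1 / 2 < ‖x‖} := ball_subset_of_norm (by linarith)
  have hb2 : ball y (2 * σ) ⊆ {x : E | 1 / 2 < ‖x‖} := ball_subset_of_norm (by linarith)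
  by_contra! hcon
  have hm : MeasurableSet (ball y (2 * σ) ∩ {x | v x < v y / 2}) :=
    ((hv.1.continuousOn.mono hb2).isOpen_inter_preimage isOpen_ball isOpen_Iio).measurableSet
  have hfin : volume (ball y (2 * σ)) ≠ ⊤ := measure_ball_lt_top.ne
  have hsum : volume.real (ball y (2 * σ) ∩ {x | v x < v y / 2}) +
      volume.real (ball y (2 * σ) ∩ {x | v y / 2 ≤ v x}) = volume.real (ball y (2 * σ)) := by
    rw [← measureReal_inter_add_sdiff (s := ball y (2 * σ)) hm hfin]
    congr 2
    · ext z; simp only [mem_inter_iff]; tauto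
    · ext z; simp only [mem_inter_iff, Set.mem_sdiff, mem_ofPred_eq, not_and, not_lt]; tauto
  by_cases hcase : volume.real (ball y (2 * σ)) ≤
      2 * volume.real (ball y (2 * σ) ∩ {x | v y / 2 ≤ v x})
  · have h1 := Hg v y (2 * σ) (v y / 2) (by positivity) (by positivity) (hv.mono hb4)
      (fun z hz => hv0 z (hb4 hz)) hcase
    rw [mul_div_cancel_left₀ _ two_ne_zero] at h1
    have h2 := hexp.to_unit_sphere hc hE (t := c * (v y / 2)) (by positivity) hy hy' hx n h1
    have : c ^ (n + 385) * v y = 2 * (c ^ (n + 384) * (c * (v y / 2))) := by ring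
    linarith
  · have hneg := hv.comp_homothety hΩ (-1) ((1 + c / 4) * v y) 0 one_pos
    simp only [one_smul, zero_add] at hneg
    have h1 := Hg _ y (2 * σ) (v y / 2) (by positivity) (by positivity) (hneg.mono hb4)
      (fun z hz => by have := hcon z hz; linarith) ?_ y (mem_ball_self (by positivity))
    · nlinarith
    · have h2 : volume.real (ball y (2 * σ) ∩ {x | v x < v y / 2}) ≤ volume.real
          (ball y (2 * σ) ∩ {x | v y / 2 ≤ -1 * v x + (1 + c / 4) * v y}) := by
        refine measureReal_mono (fun z hz => ⟨hz.1, ?_⟩)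
          (measure_ne_top_of_subset inter_subset_left hfin)
        have : v z < v y / 2 := hz.2
        rw [mem_ofPred_eq]
        nlinarith
      linarith

theorem exists_harnack_unit_sphere {p : ℝ} (hp : 1 < p) (hE : 2 ≤ Module.finrank ℝ E) :
    ∃ C : ℝ, 0 < C ∧ ∀ v : E → ℝ, IsPHarmonicOn p {x : E | 1 / 2 < ‖x‖} v →
      (∀ x : E, 1 / 2 < ‖x‖ → 0 < v x) → ∀ x y : E, ‖x‖ = 1 → ‖y‖ = 1 → v y ≤ C * v x := by
  obtain ⟨c, hc, hc1, H⟩ := exists_growth_of_large (E := E) hp hE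
  obtain ⟨L, hL⟩ := pow_unbounded_of_one_lt c⁻¹ (show 1 < 1 + c / 4 by linarith)
  obtain ⟨m, hm⟩ := pow_unbounded_of_one_lt (L : ℝ) one_lt_two
  have hLm : L * (1 / 2 : ℝ) ^ m ≤ 1 := by
    rw [one_div, inv_pow, ← div_eq_mul_inv, div_le_one (by positivity)]
    exact hm.le
  refine ⟨2 / c ^ (m + 385), by positivity, fun v hv hv0 x y hx hy => ?_⟩
  by_contra! hcon
  have hvx : 0 < v x := hv0 x (by rw [hx]; norm_num)
  rw [div_mul_eq_mul_div, div_lt_iff₀ (by positivity)] at hcon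
  have hnorm : ∀ z : E, dist z y ≤ 1 / 8 → 7 / 8 ≤ ‖z‖ ∧ ‖z‖ ≤ 9 / 8 := by
    intro z hz
    have h1 := abs_norm_sub_norm_le z y
    rw [← dist_eq_norm, hy, abs_le] at h1
    constructor <;> linarith [h1.1, h1.2]
  have inner : ∀ (j : ℕ) (z : E), dist z y + L * (1 / 16 * (1 / 2) ^ (m + j)) ≤ 1 / 8 →
      2 * v x < c ^ (m + j + 385) * v z → ∀ i : ℕ, i ≤ L →
      ∃ z', dist z' z ≤ i * (1 / 16 * (1 / 2) ^ (m + j)) ∧ (1 + c / 4) ^ i * v z ≤ v z' := by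
    intro j z hz hlarge i
    have hpos : 0 < v z := by
      by_contra! hneg
      have : c ^ (m + j + 385) * v z ≤ 0 := mul_nonpos_of_nonneg_of_nonpos (by positivity) hneg
      linarith
    induction i with
    | zero => exact fun _ => ⟨z, by simp, by simp⟩
    | succ i ih =>
      intro hi
      obtain ⟨z', hz', hv'⟩ := ih (by omega)
      have hiL : (i : ℝ) ≤ L := by exact_mod_cast (by omega : i ≤ L)
      have hd : dist z' y ≤ 1 / 8 := by
        have := dist_triangle z' z y
        have : (i : ℝ) * (1 / 16 * (1 / 2) ^ (m + j)) ≤ L * (1 / 16 * (1 / 2) ^ (m + j)) := by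
          gcongr
        linarith
      have h1 : 1 ≤ (1 + c / 4) ^ i := one_le_pow₀ (by linarith)
      have h2 : v z ≤ v z' := by nlinarith
      obtain ⟨z'', hz'', hv''⟩ := H v hv hv0 x z' (m + j) hx (hnorm z' hd).1 (hnorm z' hd).2
        (hlarge.trans_le (by gcongr))
      refine ⟨z'', ?_, ?_⟩
      · have := dist_triangle z'' z' z
        rw [mem_ball] at hz''
        push_cast
        linarith
      · refine le_trans ?_ hv''
        rw [pow_succ', mul_assoc]
        gcongr
  have outer : ∀ j : ℕ, ∃ z, dist z y ≤ 1 / 8 * (1 - (1 / 2) ^ j) ∧ c⁻¹ ^ j * v y ≤ v z := by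
    intro j
    induction j with
    | zero => exact ⟨y, by simp, by simp⟩
    | succ j ih =>
      obtain ⟨z, hz, hvz⟩ := ih
      have hstep : L * (1 / 16 * (1 / 2 : ℝ) ^ (m + j)) ≤ 1 / 16 * (1 / 2) ^ j := by
        rw [pow_add]
        have : (L * (1 / 2 : ℝ) ^ m) * (1 / 16 * (1 / 2) ^ j) ≤ 1 * (1 / 16 * (1 / 2) ^ j) := by
          gcongr
        linarith
      have hj0 : (0 : ℝ) < (1 / 2) ^ j := by positivity
      obtain ⟨z', hz', hv'⟩ := inner j z (by linarith) (by
        calc 2 * v x < v y * c ^ (m + 385) := hcon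
          _ = c ^ (m + j + 385) * (c⁻¹ ^ j * v y) := by
            rw [inv_pow]; field_simp; ring
          _ ≤ _ := by gcongr) L le_rfl
      refine ⟨z', ?_, ?_⟩
      · have := dist_triangle z' z y
        rw [pow_succ]
        linarith
      · refine le_trans ?_ hv'
        have hvy : 0 < v y := hv0 y (by rw [hy]; norm_num)
        calc c⁻¹ ^ (j + 1) * v y = c⁻¹ * (c⁻¹ ^ j * v y) := by ring
          _ ≤ (1 + c / 4) ^ L * v z := by gcongr
  have hK : IsCompact (closedBall y (1 / 8)) := isCompact_closedBall _ _
  obtain ⟨B, hB⟩ := hK.bddAbove_image (f := v) (hv.1.continuousOn.mono fun z hz => by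
    have := (hnorm z hz).1
    rw [mem_ofPred_eq]; linarith)
  have hvy : 0 < v y := hv0 y (by rw [hy]; norm_num)
  obtain ⟨j, hj⟩ := pow_unbounded_of_one_lt (B / v y) ((one_lt_inv₀ hc).2 hc1)
  obtain ⟨z, hz, hvz⟩ := outer j
  have hj0 : (0 : ℝ) < (1 / 2) ^ j := by positivity
  have := hB (mem_image_of_mem v (show z ∈ closedBall y (1 / 8) by
    rw [mem_closedBall]; linarith))
  rw [div_lt_iff₀ hvy] at hj
  linarith

/-- Harnack's inequality on spheres for positive `p`-harmonic functions in exterior domains. -/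
theorem exists_harnack_sphere {p : ℝ} (hp : 1 < p) (hE : 2 ≤ Module.finrank ℝ E) :
    ∃ C : ℝ, 0 < C ∧ ∀ (v : E → ℝ) (R r : ℝ), 0 < r → 2 * R ≤ r →
      IsPHarmonicOn p {x : E | R < ‖x‖} v → (∀ x : E, R < ‖x‖ → 0 < v x) →
      ∀ x y : E, ‖x‖ = r → ‖y‖ = r → v y ≤ C * v x := by
  obtain ⟨C, hC, H⟩ := exists_harnack_unit_sphere (E := E) hp hE
  refine ⟨C, hC, fun v R r hr hR hv hv0 x y hx hy => ?_⟩
  have h1 := hv.comp_homothety (isOpen_lt continuous_const continuous_norm) 1 0 0 hr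
  simp only [one_mul, zero_add, add_zero] at h1
  have hsub : ∀ z : E, 1 / 2 < ‖z‖ → R < ‖r • z‖ := fun z hz => by
    rw [norm_smul, Real.norm_of_nonneg hr.le]
    nlinarith
  have := H _ (h1.mono hsub) (fun z hz => hv0 _ (hsub z hz)) (r⁻¹ • x) (r⁻¹ • y)
    (by rw [norm_smul, norm_inv, Real.norm_of_nonneg hr.le, hx, inv_mul_cancel₀ hr.ne'])
    (by rw [norm_smul, norm_inv, Real.norm_of_nonneg hr.le, hy, inv_mul_cancel₀ hr.ne'])
  simpa only [smul_smul, mul_inv_cancel₀ hr.ne', one_smul] using this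

end PHarmonic

section PHarmonic

variable {E : Type*} [NormedAddCommGroup E] [InnerProductSpace ℝ E] [FiniteDimensional ℝ E]
  [MeasurableSpace E] [BorelSpace E]

theorem hasFDerivAt_posPart_const_sub_rpow {q : ℝ} (hq : 1 < q) (k : ℝ) {w : E → ℝ} {x : E}
    (hw : DifferentiableAt ℝ w x) :
    HasFDerivAt (fun x => (max (k - w x) 0) ^ q)
      (-(q * (max (k - w x) 0) ^ (q - 1)) • fderiv ℝ w x) x := by
  have := (hasDerivAt_posPart_rpow hq (k - w x)).comp_hasFDerivAt x (hw.hasFDerivAt.const_sub k)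
  rwa [smul_neg, ← neg_smul] at this

theorem le_of_ae_fderiv_eq_zero {U K : Set E} (hU : IsOpen U) (hK : IsClosed K) (hKU : K ⊆ U)
    {w : E → ℝ} (hw : ContDiffOn ℝ 1 w U) {k : ℝ} (hwK : ∀ x ∈ U, x ∉ K → k ≤ w x)
    (hne : ∃ z, z ∉ U) (hae : ∀ᵐ x, x ∈ U → w x < k → fderiv ℝ w x = 0) :
    ∀ x ∈ U, k ≤ w x := by
  obtain ⟨h1, h2⟩ := contDiff_indicator_of_isClosed hU hK hKU
    (φ := fun x => (max (k - w x) 0) ^ (2 : ℝ))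
    ((contDiff_posPart_rpow one_lt_two).comp_contDiffOn (contDiffOn_const.sub hw))
    (fun x hx hxK => by
      rw [max_eq_right (by linarith [hwK x hx hxK]), Real.zero_rpow two_ne_zero])
  set h : E → ℝ := U.indicator fun x => (max (k - w x) 0) ^ (2 : ℝ) with hh
  have hfd : fderiv ℝ h = 0 := by
    refine (Continuous.ae_eq_iff_eq volume (h1.continuous_fderiv one_ne_zero) continuous_zero).1 ?_
    filter_upwards [hae] with x hx
    by_cases hxU : x ∈ U
    · have hd := hasFDerivAt_posPart_const_sub_rpow one_lt_two k
        ((hw.differentiableOn one_ne_zero).differentiableAt (hU.mem_nhds hxU))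
      have heq : h =ᶠ[𝓝 x] fun x => (max (k - w x) 0) ^ (2 : ℝ) := by
        filter_upwards [hU.mem_nhds hxU] with z hz using indicator_of_mem hz _
      rw [(hd.congr_of_eventuallyEq heq).fderiv, Pi.zero_apply]
      by_cases hk : w x < k
      · rw [hx hxU hk, smul_zero]
      · rw [max_eq_right (by linarith), Real.zero_rpow (by norm_num)]
        simp
    · exact image_eq_zero_of_notMem_tsupport fun h' =>
        hxU (hKU (h2 (tsupport_fderiv_subset ℝ h')))
  obtain ⟨z, hz⟩ := hne
  intro x hx
  have := is_const_of_fderiv_eq_zero (𝕜 := ℝ) (h1.differentiable one_ne_zero)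
    (fun x => congrFun hfd x) x z
  rw [hh, indicator_of_notMem hz, indicator_of_mem hx,
    Real.rpow_eq_zero (le_max_right _ _) two_ne_zero] at this
  have h3 := le_max_left (k - w x) 0
  linarith

/-- Minimum principle for `p`-harmonic functions. -/
theorem IsPHarmonicOn.le_of_le_frontier {p : ℝ} (hp : 1 < p) {Ω U : Set E} {w : E → ℝ}
    (hw : IsPHarmonicOn p Ω w) (hU : IsOpen U) (hUc : IsCompact (closure U))
    (hUΩ : closure U ⊆ Ω) (hne : ∃ z, z ∉ U) {k : ℝ} (hk : ∀ x ∈ frontier U, k ≤ w x) :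
    ∀ x ∈ U, k ≤ w x := by
  suffices H : ∀ k' < k, ∀ x ∈ U, k' ≤ w x from fun x hx => le_of_forall_lt fun k' hk' => by
    obtain ⟨k'', h1, h2⟩ := exists_between hk'
    exact h1.trans_le (H k'' h2 x hx)
  intro k' hk'
  have hp0 : 0 < p := by linarith
  have hwU : IsPHarmonicOn p U w := hw.mono (subset_closure.trans hUΩ)
  have hd : ∀ x ∈ U, DifferentiableAt ℝ w x := fun x hx =>
    (hwU.1.differentiableOn one_ne_zero).differentiableAt (hU.mem_nhds hx)
  set K : Set E := closure U ∩ w ⁻¹' Iic k' with hKdef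
  have hKc : IsClosed K :=
    (hw.1.continuousOn.mono hUΩ).preimage_isClosed_of_isClosed isClosed_closure isClosed_Iic
  have hK : IsCompact K := hUc.of_isClosed_subset hKc inter_subset_left
  have hKU : K ⊆ U := by
    rintro x ⟨hx1, hx2⟩
    by_contra hxU
    have := hk x ⟨hx1, by rwa [hU.interior_eq]⟩
    rw [mem_preimage, mem_Iic] at hx2
    linarith
  have hUK : ∀ x ∈ U, x ∉ K → k' ≤ w x := fun x hx hxK => by
    by_contra! hcon
    exact hxK ⟨subset_closure hx, hcon.le⟩
  set s : E → ℝ := fun x => max (k' - w x) 0 with hs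
  have hs0 : ∀ x, 0 ≤ s x := fun x => le_max_right _ _
  obtain ⟨hQi, hQ⟩ := hwU.caccioppoli_indicator hp hU hK hKU (ζ := fun _ => 1)
    (G := fun x => s x ^ (2 : ℝ)) (g := fun x => 2 * s x ^ ((2 : ℝ) - 1))
    (w := fun x => s x ^ (2 : ℝ) / (2 * s x ^ ((2 : ℝ) - 1)) ^ ((p - 1) / p)) (ζ' := fun _ => 0)
    contDiffOn_const
    ((contDiff_posPart_rpow one_lt_two).comp_contDiffOn (contDiffOn_const.sub hwU.1))
    (fun x hx hxK => Or.inr (by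
      simp only [hs]
      rw [max_eq_right (by linarith [hUK x hx hxK]), Real.zero_rpow two_ne_zero]))
    (fun x _ => hasFDerivAt_const _ _)
    (fun x hx => hasFDerivAt_posPart_const_sub_rpow one_lt_two k' (hd x hx))
    (fun x _ => Real.rpow_nonneg (hs0 x) _)
    (fun x _ => mul_nonneg zero_le_two (Real.rpow_nonneg (hs0 x) _))
    (fun x _ => by have := hs0 x; positivity)
    (fun x _ _ => by
      rcases (hs0 x).eq_or_lt with h | h
      · rw [← h, Real.zero_rpow two_ne_zero, zero_div, zero_mul]
      · exact le_of_eq (by field_simp))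
    (by
      simp only [show (2 : ℝ) - 1 = 1 by norm_num, Real.rpow_one]
      exact continuousOn_const.mul
        ((continuousOn_const.sub hwU.1.continuousOn).sup continuousOn_const))
    (by simp [Real.zero_rpow hp0.ne'])
  simp only [norm_zero, mul_zero, Real.zero_rpow hp0.ne', integral_zero] at hQ
  have hQ0 : ∀ x, 0 ≤ (max (1 : ℝ) 0) ^ p * (2 * s x ^ ((2 : ℝ) - 1)) * ‖gradient w x‖ ^ p :=
    fun x => by have := hs0 x; positivity
  have hz := (setIntegral_eq_zero_iff_of_nonneg_ae (ae_of_all _ hQ0) hQi).1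
    (le_antisymm hQ (integral_nonneg hQ0))
  refine le_of_ae_fderiv_eq_zero hU hKc hKU hwU.1 hUK hne ?_
  filter_upwards [(ae_restrict_iff' hU.measurableSet).1 hz] with x hx hxU hxk
  have h1 := hx hxU
  have h2 : 0 < s x := lt_max_of_lt_left (by linarith)
  have h3 : ‖gradient w x‖ ^ p = 0 := by
    rw [Pi.zero_apply, mul_eq_zero] at h1
    refine h1.resolve_left (ne_of_gt ?_)
    rw [max_eq_left zero_le_one]
    positivity
  rwa [Real.rpow_eq_zero (norm_nonneg _) hp0.ne', norm_gradient, norm_eq_zero] at h3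

theorem frontier_annulus_subset (R₁ R₂ : ℝ) :
    closure {x : E | R₁ < ‖x‖ ∧ ‖x‖ < R₂} ⊆ {x | R₁ ≤ ‖x‖ ∧ ‖x‖ ≤ R₂} ∧
      frontier {x : E | R₁ < ‖x‖ ∧ ‖x‖ < R₂} ⊆ {x | ‖x‖ = R₁ ∨ ‖x‖ = R₂} := by
  have hc : closure {x : E | R₁ < ‖x‖ ∧ ‖x‖ < R₂} ⊆ {x | R₁ ≤ ‖x‖ ∧ ‖x‖ ≤ R₂} :=
    closure_minimal (fun x hx => ⟨hx.1.le, hx.2.le⟩)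
      ((isClosed_le continuous_const continuous_norm).inter
        (isClosed_le continuous_norm continuous_const))
  have ho : IsOpen {x : E | R₁ < ‖x‖ ∧ ‖x‖ < R₂} :=
    (isOpen_lt continuous_const continuous_norm).inter (isOpen_lt continuous_norm continuous_const)
  refine ⟨hc, fun x hx => ?_⟩
  rw [ho.frontier_eq] at hx
  have h1 := hc hx.1
  by_contra hcon
  rw [mem_ofPred_eq, not_or] at hcon
  exact hx.2 ⟨lt_of_le_of_ne h1.1 (Ne.symm hcon.1), lt_of_le_of_ne h1.2 hcon.2⟩

theorem IsPHarmonicOn.le_of_le_spheres {p : ℝ} (hp : 1 < p) {R R₁ R₂ : ℝ} (hR : 0 < R)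
    (hR₁ : R < R₁) {w : E → ℝ} (hw : IsPHarmonicOn p {x : E | R < ‖x‖} w) {k : ℝ}
    (h₁ : ∀ x, ‖x‖ = R₁ → k ≤ w x) (h₂ : ∀ x, ‖x‖ = R₂ → k ≤ w x) {x : E} (hx₁ : R₁ ≤ ‖x‖)
    (hx₂ : ‖x‖ ≤ R₂) : k ≤ w x := by
  obtain ⟨hc, hf⟩ := frontier_annulus_subset (E := E) R₁ R₂
  rcases hx₁.eq_or_lt with h | h
  · exact h₁ x h.symm
  rcases hx₂.eq_or_lt with h' | h'
  · exact h₂ x h'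
  refine hw.le_of_le_frontier hp (U := {x : E | R₁ < ‖x‖ ∧ ‖x‖ < R₂})
    ((isOpen_lt continuous_const continuous_norm).inter (isOpen_lt continuous_norm continuous_const))
    ((isCompact_closedBall (0 : E) R₂).of_isClosed_subset isClosed_closure fun z hz => by
      rw [mem_closedBall_zero_iff]; exact (hc hz).2)
    (fun z hz => hR₁.trans_le (hc hz).1) ⟨0, fun h0 => ?_⟩ (fun z hz => ?_) x ⟨h, h'⟩
  · have := h0.1
    rw [norm_zero] at this
    linarith
  · rcases hf hz with h | h
    · exact h₁ z h
    · exact h₂ z h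

theorem IsPHarmonicOn.le_of_spheres_le {p : ℝ} (hp : 1 < p) {R R₁ R₂ : ℝ} (hR : 0 < R)
    (hR₁ : R < R₁) {w : E → ℝ} (hw : IsPHarmonicOn p {x : E | R < ‖x‖} w) {k : ℝ}
    (h₁ : ∀ x, ‖x‖ = R₁ → w x ≤ k) (h₂ : ∀ x, ‖x‖ = R₂ → w x ≤ k) {x : E} (hx₁ : R₁ ≤ ‖x‖)
    (hx₂ : ‖x‖ ≤ R₂) : w x ≤ k := by
  have hneg := hw.comp_homothety (isOpen_lt continuous_const continuous_norm) (-1) 0 0 one_pos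
  simp only [one_smul, zero_add, add_zero, neg_one_mul] at hneg
  have := hneg.le_of_le_spheres hp hR hR₁ (k := -k) (fun x hx => neg_le_neg (h₁ x hx))
    (fun x hx => neg_le_neg (h₂ x hx)) hx₁ hx₂
  linarith

end PHarmonic

section PHarmonic

variable {E : Type*} [NormedAddCommGroup E] [InnerProductSpace ℝ E] [FiniteDimensional ℝ E]
  [MeasurableSpace E] [BorelSpace E]

/-- A positive `p`-harmonic function in an exterior domain has a limit in `[0, ∞]` at infinity. -/
theorem IsPHarmonicOn.tendsto_cobounded {p : ℝ} (hp : 1 < p) (hE : 2 ≤ Module.finrank ℝ E)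
    {R : ℝ} (hR : 0 < R) {u : E → ℝ} (hu : IsPHarmonicOn p {x : E | R < ‖x‖} u)
    (hpos : ∀ x, R < ‖x‖ → 0 < u x) :
    (∃ c : ℝ, 0 ≤ c ∧ Tendsto u (Bornology.cobounded E) (𝓝 c)) ∨
      Tendsto u (Bornology.cobounded E) atTop := by
  have hbasis := hasBasis_cobounded_norm (E := E)
  obtain ⟨C, hC, hH⟩ := exists_harnack_sphere hp hE
  set A : Set ℝ := {a | ∀ᶠ x in Bornology.cobounded E, a ≤ u x} with hA
  have h0A : (0 : ℝ) ∈ A := hbasis.eventually_iff.2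
    ⟨R + 1, trivial, fun x hx => (hpos x (by rw [mem_ofPred_eq] at hx; linarith)).le⟩
  by_cases hbdd : BddAbove A
  swap
  · refine Or.inr (tendsto_atTop.2 fun b => ?_)
    obtain ⟨a, ha, hba⟩ := not_bddAbove_iff.1 hbdd b
    exact ha.mono fun x hx => hba.le.trans hx
  refine Or.inl ⟨sSup A, le_csSup hbdd h0A, Metric.tendsto_nhds.2 fun ε' hε' => ?_⟩
  set m := sSup A
  set ε := ε' / (2 * C + 1) with hεdef
  have hε : 0 < ε := by positivity
  have hεC : ε * (2 * C + 1) = ε' := div_mul_cancel₀ _ (by positivity)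
  obtain ⟨a, ha, hma⟩ := exists_lt_of_lt_csSup ⟨0, h0A⟩ (show m - ε < m by linarith)
  obtain ⟨R₁, -, hR₁⟩ := hbasis.eventually_iff.1 ha
  have hfreq : ∀ N : ℝ, ∃ x : E, N ≤ ‖x‖ ∧ u x < m + ε := by
    by_contra! hcon
    obtain ⟨N, hN⟩ := hcon
    have : m + ε ≤ m := le_csSup hbdd (hbasis.eventually_iff.2 ⟨N, trivial, fun x hx => hN x hx⟩)
    linarith
  set R₂ := max R R₁
  have hR₂ : 0 < R₂ := lt_max_of_lt_left hR
  have hv := (hu.mono (Ω' := {x : E | R₂ < ‖x‖})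
    fun x hx => (le_max_left R R₁).trans_lt hx).comp_homothety
    (isOpen_lt continuous_const continuous_norm) 1 (ε - m) 0 one_pos
  simp only [one_smul, zero_add, one_mul] at hv
  have hv0 : ∀ x : E, R₂ < ‖x‖ → 0 < u x + (ε - m) := fun x hx => by
    have : a ≤ u x := hR₁ ((le_max_right R R₁).trans hx.le)
    linarith
  have hsph : ∀ x : E, 2 * R₂ ≤ ‖x‖ → u x < m + ε →
      ∀ y, ‖y‖ = ‖x‖ → u y + (ε - m) ≤ C * (2 * ε) := fun x hx hux y hy =>
    (hH _ R₂ ‖x‖ (by linarith) hx hv hv0 x y rfl hy).trans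
      (mul_le_mul_of_nonneg_left (by linarith) hC.le)
  obtain ⟨x₁, hx₁, hux₁⟩ := hfreq (2 * R₂)
  refine hbasis.eventually_iff.2 ⟨‖x₁‖, trivial, fun x (hx : ‖x₁‖ ≤ ‖x‖) => ?_⟩
  obtain ⟨x₂, hx₂, hux₂⟩ := hfreq ‖x‖
  have h1 := hv.le_of_spheres_le hp hR₂ (R₁ := ‖x₁‖) (R₂ := ‖x₂‖) (k := C * (2 * ε))
    (by linarith) (hsph x₁ hx₁ hux₁) (hsph x₂ (by linarith) hux₂) hx hx₂
  have h2 := hv0 x (by linarith)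
  rw [Real.dist_eq, abs_lt]
  constructor <;> nlinarith

theorem integral_norm_pow_finrank_inv [Nontrivial E] {T : ℝ} (hT : 1 ≤ T) :
    IntegrableOn (fun x : E => (‖x‖ ^ Module.finrank ℝ E)⁻¹) {x | 1 < ‖x‖ ∧ ‖x‖ ≤ T} ∧
    ∫ x in {x : E | 1 < ‖x‖ ∧ ‖x‖ ≤ T}, (‖x‖ ^ Module.finrank ℝ E)⁻¹ =
      Module.finrank ℝ E * volume.real (ball (0 : E) 1) * Real.log T := by
  have hd : 0 < Module.finrank ℝ E := Module.finrank_pos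
  set d := Module.finrank ℝ E with hd_def
  have hm : MeasurableSet {x : E | 1 < ‖x‖ ∧ ‖x‖ ≤ T} :=
    measurable_norm measurableSet_Ioc
  set f : ℝ → ℝ := (Ioc 1 T).indicator fun y => (y ^ d)⁻¹
  have hf1 : ∀ y ∈ Ioc 1 T, f y = (y ^ d)⁻¹ := fun y hy => indicator_of_mem hy _
  have hf2 : ∀ y ∉ Ioc 1 T, f y = 0 := fun y hy => indicator_of_notMem hy _
  have hf : {x : E | 1 < ‖x‖ ∧ ‖x‖ ≤ T}.indicator (fun x : E => (‖x‖ ^ d)⁻¹) = fun x => f ‖x‖ := by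
    ext x
    by_cases hx : 1 < ‖x‖ ∧ ‖x‖ ≤ T
    · rw [indicator_of_mem (by exact hx), hf1 _ hx]
    · rw [indicator_of_notMem (by exact hx), hf2 _ hx]
  have hg : (fun y : ℝ => y ^ (d - 1) • f y) = (Ioc 1 T).indicator fun y => y⁻¹ := by
    ext y
    by_cases hy : y ∈ Ioc 1 T
    · have : y ≠ 0 := by linarith [hy.1]
      rw [hf1 y hy, indicator_of_mem hy, smul_eq_mul]
      obtain ⟨n, hn⟩ := Nat.exists_eq_succ_of_ne_zero hd.ne'
      rw [hn, Nat.succ_sub_one, Nat.succ_eq_add_one, pow_succ]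
      field_simp
    · rw [hf2 y hy, indicator_of_notMem hy, smul_zero]
  have hsub : Ioc 1 T ⊆ Ioi (0 : ℝ) := fun y hy => zero_lt_one.trans hy.1
  have hint : IntegrableOn (fun y : ℝ => y⁻¹) (Ioc 1 T) :=
    (ContinuousOn.integrableOn_Icc (continuousOn_inv₀.mono fun y hy => by
      have := hy.1; simp only [mem_compl_iff, mem_singleton_iff]; linarith)).mono_set
      Ioc_subset_Icc_self
  constructor
  · rw [← integrable_indicator_iff hm, hf, integrable_fun_norm_addHaar, hg]
    exact (integrable_indicator_iff measurableSet_Ioc).2 hint |>.integrableOn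
  · rw [← integral_indicator hm, hf, integral_fun_norm_addHaar, hg, nsmul_eq_mul, smul_eq_mul,
      setIntegral_indicator measurableSet_Ioc, inter_eq_right.2 hsub,
      ← intervalIntegral.integral_of_le hT, integral_inv_of_pos one_pos (by linarith), div_one,
      mul_assoc]

theorem hasFDerivAt_const_sub_log_norm_sq (c : ℝ) {x : E} (hx : x ≠ 0) :
    HasFDerivAt (fun x : E => c - Real.log (‖x‖ ^ 2)) (-((‖x‖ ^ 2)⁻¹ • (2 • innerSL ℝ x))) x :=
  ((hasStrictFDerivAt_norm_sq x).hasFDerivAt.log (by simpa using hx)).const_sub c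

theorem norm_inv_norm_sq_smul_innerSL (x : E) :
    ‖-((‖x‖ ^ 2)⁻¹ • (2 • innerSL ℝ x))‖ = 2 / ‖x‖ := by
  rw [norm_neg, norm_smul, ← Nat.cast_smul_eq_nsmul ℝ, norm_smul, innerSL_apply_norm]
  rcases eq_or_ne x 0 with rfl | hx
  · simp
  · have : ‖x‖ ≠ 0 := norm_ne_zero_iff.2 hx
    simp only [norm_inv, norm_pow, norm_norm, Nat.cast_ofNat, Real.norm_ofNat]
    field_simp

end PHarmonic

section PHarmonic

variable {E : Type*} [NormedAddCommGroup E] [InnerProductSpace ℝ E] [FiniteDimensional ℝ E]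
  [MeasurableSpace E] [BorelSpace E]

/-- The `p`-capacity estimate for logarithmic cutoff functions in dimension at most `p`. -/
theorem integral_log_cutoff_le [Nontrivial E] {p : ℝ}
    (hd : (Module.finrank ℝ E : ℝ) ≤ p) {c L : ℝ} (hc : 0 ≤ c) (hL : 0 ≤ L) {S : Set E}
    (hSm : MeasurableSet S) (hS : S ⊆ {x | 1 < ‖x‖ ∧ ‖x‖ ≤ Real.exp L}) :
    IntegrableOn (fun x : E => (c * ‖-((‖x‖ ^ 2)⁻¹ • (2 • innerSL ℝ x))‖) ^ p) S ∧
    ∫ x in S, (c * ‖-((‖x‖ ^ 2)⁻¹ • (2 • innerSL ℝ x))‖) ^ p ≤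
      (2 * c) ^ p * (Module.finrank ℝ E * volume.real (ball (0 : E) 1)) * L := by
  obtain ⟨h1, h2⟩ := integral_norm_pow_finrank_inv (E := E) (Real.one_le_exp hL)
  rw [Real.log_exp] at h2
  have hle : ∀ x ∈ S, (c * ‖-((‖x‖ ^ 2)⁻¹ • (2 • innerSL ℝ x))‖) ^ p ≤
      (2 * c) ^ p * (‖x‖ ^ Module.finrank ℝ E)⁻¹ := fun x hx => by
    have hx1 := (hS hx).1
    rw [norm_inv_norm_sq_smul_innerSL, mul_div_assoc', mul_comm c, Real.div_rpow (by positivity)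
      (norm_nonneg _), div_eq_mul_inv, ← Real.rpow_natCast]
    gcongr
    exact hx1.le
  have h3 : IntegrableOn (fun x : E => (2 * c) ^ p * (‖x‖ ^ Module.finrank ℝ E)⁻¹)
      {x | 1 < ‖x‖ ∧ ‖x‖ ≤ Real.exp L} := h1.const_mul _
  have h4 : IntegrableOn (fun x : E => (c * ‖-((‖x‖ ^ 2)⁻¹ • (2 • innerSL ℝ x))‖) ^ p) S := by
    refine (h3.mono_set hS).mono' ?_ ?_
    · simp only [norm_inv_norm_sq_smul_innerSL]
      exact (((measurable_norm.const_div 2).const_mul c).pow_const p).aestronglyMeasurable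
    · refine (ae_restrict_iff' hSm).2 (ae_of_all _ fun x hx => ?_)
      rw [Real.norm_of_nonneg (by positivity)]
      exact hle x hx
  refine ⟨h4, (setIntegral_mono_on h4 (h3.mono_set hS) hSm hle).trans ?_⟩
  refine (setIntegral_mono_set h3 (ae_of_all _ fun x => ?_) (LE.le.eventuallyLE hS)).trans ?_
  · simp only [Pi.zero_apply]; positivity
  · rw [integral_const_mul, h2, ← mul_assoc]

theorem nonpos_of_rpow_mul_le {p c C L₀ : ℝ} (hp : 1 < p)
    (h : ∀ L, L₀ ≤ L → L ^ p * c ≤ C * L) : c ≤ 0 := by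
  by_contra! hc
  have h1 := (tendsto_rpow_atTop (show 0 < p - 1 by linarith)).eventually_gt_atTop (C / c)
  obtain ⟨L, hL, hL0, hL1⟩ :=
    (h1.and ((eventually_ge_atTop L₀).and (eventually_gt_atTop 0))).exists
  have h2 := h L hL0
  rw [div_lt_iff₀ hc] at hL
  rw [show p = p - 1 + 1 by ring, Real.rpow_add_one hL1.ne'] at h2
  nlinarith

/-- If `p` is at least the dimension, exterior domains are `p`-parabolic: a positive `p`-harmonic
function in an exterior domain is bounded below by its minimum on a sphere. -/
theorem IsPHarmonicOn.le_of_le_sphere [Nontrivial E] {p : ℝ} (hp : 1 < p)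
    (hd : (Module.finrank ℝ E : ℝ) ≤ p) {R R₁ : ℝ} (hR : R < R₁) (hR₁ : 1 ≤ R₁)
    {u : E → ℝ} (hu : IsPHarmonicOn p {x : E | R < ‖x‖} u) (hpos : ∀ x, R < ‖x‖ → 0 < u x)
    {k : ℝ} (hk : ∀ x, ‖x‖ = R₁ → k ≤ u x) {x : E} (hx : R₁ < ‖x‖) : k ≤ u x := by
  suffices H : ∀ k' < k, 0 < k' → k' ≤ u x by
    refine le_of_forall_lt fun k' hk' => ?_
    rcases le_or_gt k' 0 with h | h
    · exact h.trans_lt (hpos x (hR.trans hx))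
    · obtain ⟨k'', h1, h2⟩ := exists_between hk'
      exact h1.trans_le (H k'' h2 (h.trans h1))
  intro k' hk' hk0
  have hp0 : 0 < p := by linarith
  set U : Set E := {x | R₁ < ‖x‖} with hUdef
  have hU : IsOpen U := isOpen_lt continuous_const continuous_norm
  have hUne : ∀ x ∈ U, x ≠ 0 := by
    rintro x hx rfl
    rw [hUdef, mem_ofPred_eq, norm_zero] at hx
    linarith
  have hU1 : ∀ x ∈ U, 1 < ‖x‖ := fun x hx => hR₁.trans_lt hx
  have huU : IsPHarmonicOn p U u := hu.mono fun x hx => hR.trans hx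
  have hdiff : ∀ x ∈ U, DifferentiableAt ℝ u x := fun x hx =>
    (huU.1.differentiableOn one_ne_zero).differentiableAt (hU.mem_nhds hx)
  set K : Set E := {x | R₁ ≤ ‖x‖} ∩ u ⁻¹' Iic k' with hKdef
  have hKc : IsClosed K :=
    (hu.1.continuousOn.mono fun x hx => hR.trans_le hx).preimage_isClosed_of_isClosed
      (isClosed_le continuous_const continuous_norm) isClosed_Iic
  have hKU : K ⊆ U := by
    rintro x ⟨hx1, hx2⟩
    refine lt_of_le_of_ne (show R₁ ≤ ‖x‖ from hx1) fun h => ?_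
    have := hk x h.symm
    rw [mem_preimage, mem_Iic] at hx2
    linarith
  have hUK : ∀ x ∈ U, x ∉ K → k' ≤ u x := fun x hx hxK => by
    by_contra! hcon
    exact hxK ⟨(show R₁ < ‖x‖ from hx).le, hcon.le⟩
  set s : E → ℝ := fun x => max (k' - u x) 0 with hs
  have hs0 : ∀ x, 0 ≤ s x := fun x => le_max_right _ _
  have hsk : ∀ x ∈ U, s x ≤ k' := fun x hx =>
    max_le (by linarith [hpos x (hR.trans hx)]) hk0.le
  set F : E → ℝ := fun x => (2 * s x ^ ((2 : ℝ) - 1)) * ‖gradient u x‖ ^ p with hF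
  have hF0 : ∀ x, 0 ≤ F x := fun x => by have := hs0 x; positivity
  set θ := (p - 1) / p with hθ
  have hθ0 : 0 ≤ θ := div_nonneg (by linarith) hp0.le
  have hθ1 : θ ≤ 1 := (div_le_one hp0).2 (by linarith)
  set W := k' ^ (2 - θ) with hW
  have hW0 : 0 ≤ W := by positivity
  have hgc : ContinuousOn (fun x => 2 * s x ^ ((2 : ℝ) - 1)) U := by
    simp only [show (2 : ℝ) - 1 = 1 by norm_num, Real.rpow_one]
    exact continuousOn_const.mul
      ((continuousOn_const.sub huU.1.continuousOn).sup continuousOn_const)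
  set V := (Module.finrank ℝ E : ℝ) * volume.real (ball (0 : E) 1)
  have key : ∀ L, 0 ≤ L →
      IntegrableOn (fun x => (max (2 * L - Real.log (‖x‖ ^ 2)) 0) ^ p * F x) U ∧
      ∫ x in U, (max (2 * L - Real.log (‖x‖ ^ 2)) 0) ^ p * F x ≤
        2 * (2 * p) ^ p * ((2 * W) ^ p * V) * L := by
    intro L hL
    have hζpos : ∀ x ∈ U, 0 < 2 * L - Real.log (‖x‖ ^ 2) → ‖x‖ ≤ Real.exp L := fun x hx h => by
      rw [Real.log_pow, Nat.cast_ofNat] at h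
      have h0 : 0 < ‖x‖ := norm_pos_iff.2 (hUne x hx)
      exact ((Real.log_le_iff_le_exp h0).1 (by linarith))
    have hζ1 : ContDiffOn ℝ 1 (fun x : E => 2 * L - Real.log (‖x‖ ^ 2)) U :=
      contDiffOn_const.sub ((contDiff_norm_sq ℝ).contDiffOn.log fun x hx => by
        simpa using hUne x hx)
    obtain ⟨hM, hMle⟩ := integral_log_cutoff_le hd hW0 hL
      (S := U ∩ {x | 0 < 2 * L - Real.log (‖x‖ ^ 2)})
      (hU.measurableSet.inter (measurableSet_lt measurable_const (by fun_prop)))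
      (fun x hx => ⟨hU1 x hx.1, hζpos x hx.1 hx.2⟩)
    obtain ⟨h1, h2⟩ := huU.caccioppoli_indicator hp hU
      ((isCompact_closedBall (0 : E) (Real.exp L)).inter_left hKc) (inter_subset_left.trans hKU)
      (ζ := fun x => 2 * L - Real.log (‖x‖ ^ 2))
      (G := fun x => s x ^ (2 : ℝ)) (g := fun x => 2 * s x ^ ((2 : ℝ) - 1))
      (w := fun _ => W) (ζ' := fun x => -((‖x‖ ^ 2)⁻¹ • (2 • innerSL ℝ x)))
      hζ1
      ((contDiff_posPart_rpow one_lt_two).comp_contDiffOn (contDiffOn_const.sub huU.1))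
      (fun x hx hxK => by
        by_cases hxK' : x ∈ K
        · refine Or.inl (not_lt.1 fun h => hxK ⟨hxK', ?_⟩)
          rw [mem_closedBall_zero_iff]
          exact hζpos x hx h
        · right
          simp only [hs]
          rw [max_eq_right (by linarith [hUK x hx hxK']), Real.zero_rpow two_ne_zero])
      (fun x hx => hasFDerivAt_const_sub_log_norm_sq _ (hUne x hx))
      (fun x hx => hasFDerivAt_posPart_const_sub_rpow one_lt_two k' (hdiff x hx))
      (fun x _ => Real.rpow_nonneg (hs0 x) _)
      (fun x _ => mul_nonneg zero_le_two (Real.rpow_nonneg (hs0 x) _))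
      (fun x _ => hW0)
      (fun x hx _ => by
        rcases (hs0 x).eq_or_lt with h | h
        · rw [← h, Real.zero_rpow two_ne_zero]
          positivity
        · calc s x ^ (2 : ℝ) = s x ^ (2 - θ) * s x ^ θ := by
                rw [← Real.rpow_add h, sub_add_cancel]
            _ ≤ W * (2 * s x ^ ((2 : ℝ) - 1)) ^ θ := by
                rw [show (2 : ℝ) - 1 = 1 by norm_num, Real.rpow_one]
                refine mul_le_mul (Real.rpow_le_rpow h.le (hsk x hx) (by linarith))
                  (Real.rpow_le_rpow h.le (by linarith) hθ0) (by positivity) hW0)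
      hgc hM
    simp only [mul_assoc, hF] at h1 h2 hMle ⊢
    exact ⟨h1, h2.trans (by
      gcongr
      exact hMle.trans_eq (by simp only [V, mul_assoc]))⟩
  have hzero : ∀ n : ℕ, ∀ᵐ x, x ∈ U ∩ {x | ‖x‖ < n} → F x = 0 := by
    intro n
    set A : Set E := U ∩ {x | ‖x‖ < n}
    have hA : MeasurableSet A :=
      hU.measurableSet.inter (measurableSet_lt measurable_norm measurable_const)
    have hAU : A ⊆ U := inter_subset_left
    set L₀ := max 1 (2 * Real.log n)
    have hle : ∀ L, L₀ ≤ L → ∀ x ∈ A,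
        L ^ p * F x ≤ (max (2 * L - Real.log (‖x‖ ^ 2)) 0) ^ p * F x := fun L hL x hx => by
      have h1 := (le_max_left _ _).trans hL
      have h2 := (le_max_right _ _).trans hL
      have h3 : Real.log ‖x‖ ≤ Real.log n :=
        Real.log_le_log (norm_pos_iff.2 (hUne x hx.1)) (show ‖x‖ < n from hx.2).le
      refine mul_le_mul_of_nonneg_right (Real.rpow_le_rpow (by linarith)
        (le_max_of_le_left ?_) hp0.le) (hF0 x)
      rw [Real.log_pow, Nat.cast_ofNat]
      linarith
    have hL₀ : 1 ≤ L₀ := le_max_left _ _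
    have hFi : IntegrableOn F A := by
      have hi := ((key L₀ (by linarith)).1.mono_set hAU)
      refine hi.mono' ?_ ((ae_restrict_iff' hA).2 (ae_of_all _ fun x hx => ?_))
      · exact ((hgc.mono hAU).aestronglyMeasurable hA).mul
          ((measurable_gradient u).norm.pow_const p).aestronglyMeasurable
      · rw [Real.norm_of_nonneg (hF0 x)]
        refine le_trans ?_ (hle L₀ le_rfl x hx)
        exact le_mul_of_one_le_left (hF0 x) (Real.one_le_rpow hL₀ hp0.le)
    have hneg : ∫ x in A, F x ≤ 0 := by
      refine nonpos_of_rpow_mul_le (L₀ := L₀) (C := 2 * (2 * p) ^ p * ((2 * W) ^ p * V)) hp fun L hL => ?_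
      obtain ⟨h1, h2⟩ := key L (by linarith)
      rw [← integral_const_mul]
      refine le_trans ?_ h2
      refine (setIntegral_mono_on (hFi.const_mul _) (h1.mono_set hAU) hA (hle L hL)).trans ?_
      exact setIntegral_mono_set h1 (ae_of_all _ fun x => mul_nonneg
        (Real.rpow_nonneg (le_max_right _ _) _) (hF0 x)) (LE.le.eventuallyLE hAU)
    exact (ae_restrict_iff' hA).1 ((setIntegral_eq_zero_iff_of_nonneg_ae (ae_of_all _ hF0) hFi).1
      (le_antisymm hneg (integral_nonneg hF0)))
  refine le_of_ae_fderiv_eq_zero hU hKc hKU huU.1 hUK ⟨0, fun h => hUne 0 h rfl⟩ ?_ x hx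
  filter_upwards [ae_all_iff.2 hzero] with x hx hxU hxk
  obtain ⟨n, hn⟩ := exists_nat_gt ‖x‖
  have h1 := hx n ⟨hxU, hn⟩
  have h2 : 0 < s x := lt_max_of_lt_left (by linarith)
  have h3 : ‖gradient u x‖ ^ p = 0 :=
    (mul_eq_zero.1 h1).resolve_left (by positivity)
  rwa [Real.rpow_eq_zero (norm_nonneg _) hp0.ne', norm_gradient, norm_eq_zero] at h3

theorem IsPHarmonicOn.limit_pos [Nontrivial E] {p : ℝ} (hp : 1 < p)
    (hd : (Module.finrank ℝ E : ℝ) ≤ p) {R : ℝ} (hR : 0 < R)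
    {u : E → ℝ} (hu : IsPHarmonicOn p {x : E | R < ‖x‖} u) (hpos : ∀ x, R < ‖x‖ → 0 < u x)
    {c : ℝ} (hc : Tendsto u (Bornology.cobounded E) (𝓝 c)) : 0 < c := by
  obtain ⟨z, hz, hmin⟩ := (isCompact_sphere (0 : E) (R + 1)).exists_isMinOn
    (NormedSpace.sphere_nonempty.2 (by linarith)) (hu.1.continuousOn.mono fun x hx => by
      rw [mem_sphere_zero_iff_norm] at hx
      rw [mem_ofPred_eq, hx]
      linarith)
  rw [mem_sphere_zero_iff_norm] at hz
  refine (hpos z (by linarith)).trans_le (ge_of_tendsto hc ?_)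
  refine hasBasis_cobounded_norm.eventually_iff.2 ⟨R + 2, trivial, fun x (hx : R + 2 ≤ ‖x‖) => ?_⟩
  exact hu.le_of_le_sphere hp hd (by linarith) (by linarith) hpos
    (fun y hy => hmin (mem_sphere_zero_iff_norm.2 hy)) (by linarith)

end PHarmonic

theorem stmt17 (d : ℕ) (hd : 2 ≤ d) (p : ℝ) (hp : 1 < p) (R₀ : ℝ) (hR₀ : 0 < R₀)
    (u : EuclideanSpace ℝ (Fin d) → ℝ)
    (hu : IsPosWeakSol p (fun _ => 0) {x : EuclideanSpace ℝ (Fin d) | R₀ < ‖x‖} u) :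
    ((∃ c : ℝ, 0 ≤ c ∧ Tendsto u (Bornology.cobounded (EuclideanSpace ℝ (Fin d))) (𝓝 c)) ∨
      Tendsto u (Bornology.cobounded (EuclideanSpace ℝ (Fin d))) atTop) ∧
    ((d : ℝ) ≤ p → ∀ c : ℝ,
      Tendsto u (Bornology.cobounded (EuclideanSpace ℝ (Fin d))) (𝓝 c) → 0 < c) := by
  have hopen : IsOpen {x : EuclideanSpace ℝ (Fin d) | R₀ < ‖x‖} :=
    isOpen_lt continuous_const continuous_norm
  have hrank : Module.finrank ℝ (EuclideanSpace ℝ (Fin d)) = d := finrank_euclideanSpace_fin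
  have : Nontrivial (EuclideanSpace ℝ (Fin d)) :=
    Module.nontrivial_of_finrank_pos (R := ℝ) (by omega)
  have hu' := hu.isPHarmonicOn hp hopen
  exact ⟨hu'.tendsto_cobounded hp (hd.trans_eq hrank.symm) hR₀ hu.2.1,
    fun hdp c hc => hu'.limit_pos hp (by rwa [hrank]) hR₀ hu.2.1 hc⟩
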